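/- Fix integers d ≥ 2 and N ≥ 1, a traceless Hermitian matrix h ∈ M_d(ℂ), and a unit vector ψ_N ∈ (ℂ^d)^{⊗N}. For U ∈ SU(d^N) define the LU-optimized quantum Fisher information F^{LU}(U) := sup over all N-tuples (V_1,…,V_N) of d×d unitary matrices of 4·(tr(ρ_V H_N²) − (tr(ρ_V H_N))²), where ρ_V := (V_1⊗⋯⊗V_N)·U|ψ_N⟩⟨ψ_N|U†·(V_1⊗⋯⊗V_N)†. Then for every ε ≥ 0, μ(d^N){ U ∈ SU(d^N) : F^{LU}(U) ≥ 4N‖h‖²·(1 + (N−1)d²/√(d^N)) + ε } ≤ exp(−ε²·d^N/(4096·‖h‖⁴·N⁴)). -/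

import Mathlib

open MeasureTheory Matrix Finset
open scoped ComplexOrder

noncomputable section

namespace Paper

instance matrixMeasurableSpace {m n : Type*} : MeasurableSpace (Matrix m n ℂ) :=
  (inferInstance : MeasurableSpace (m → n → ℂ))

/-- The operator norm (w.r.t. the Euclidean norm) of a square matrix. -/
def opNorm {n : Type*} [Fintype n] [DecidableEq n] (A : Matrix n n ℂ) : ℝ :=
  ‖Matrix.toEuclideanCLM (𝕜 := ℂ) A‖

/-- The Hamiltonian `H_N = Σ_j h^{(j)}` on `N` particles, acting as `h` on the `j`-th
tensor factor and as the identity on the others. -/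
def localHam (d N : ℕ) (h : Matrix (Fin d) (Fin d) ℂ) :
    Matrix (Fin N → Fin d) (Fin N → Fin d) ℂ :=
  ∑ j : Fin N, Matrix.of fun x y =>
    if ∀ i, i ≠ j → x i = y i then h (x j) (y j) else 0

/-- The tensor product `V_1 ⊗ ⋯ ⊗ V_N` of `N` one-particle matrices. -/
def tensorProd {d N : ℕ} (V : Fin N → Matrix (Fin d) (Fin d) ℂ) :
    Matrix (Fin N → Fin d) (Fin N → Fin d) ℂ :=
  Matrix.of fun x y => ∏ j, V j (x j) (y j)

/-- The LU-optimized quantum Fisher information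
`F^{LU}(U) = sup_{V_1,…,V_N unitary} 4·(tr(ρ_V H_N²) − (tr(ρ_V H_N))²)` where
`ρ_V = (V_1⊗⋯⊗V_N)·U|ψ⟩⟨ψ|U†·(V_1⊗⋯⊗V_N)†`. -/
def FLU (d N : ℕ) (h : Matrix (Fin d) (Fin d) ℂ) (ψ : (Fin N → Fin d) → ℂ)
    (U : Matrix.specialUnitaryGroup (Fin N → Fin d) ℂ) : ℝ :=
  ⨆ V : Fin N → Matrix.unitaryGroup (Fin d) ℂ,
    4 * ((Matrix.trace
            ((tensorProd fun j => (V j : Matrix (Fin d) (Fin d) ℂ)) *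
              (U.1 * Matrix.vecMulVec ψ (star ψ) * star U.1) *
              star (tensorProd fun j => (V j : Matrix (Fin d) (Fin d) ℂ)) *
              (localHam d N h * localHam d N h))).re -
        ((Matrix.trace
            ((tensorProd fun j => (V j : Matrix (Fin d) (Fin d) ℂ)) *
              (U.1 * Matrix.vecMulVec ψ (star ψ) * star U.1) *
              star (tensorProd fun j => (V j : Matrix (Fin d) (Fin d) ℂ)) *
              localHam d N h)).re) ^ 2)

section Gaussian

open ProbabilityTheory

variable {E : Type*} [NormedAddCommGroup E] [InnerProductSpace ℝ E] [FiniteDimensional ℝ E]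
  [MeasurableSpace E] [BorelSpace E]

/-- The exponential of any multiple of the norm is integrable for a Gaussian measure. -/
theorem integrable_exp_mul_norm_stdGaussian (t : ℝ) :
    Integrable (fun x : E => Real.exp (t * ‖x‖)) (stdGaussian E) := by
  obtain ⟨C, hC, hint⟩ := IsGaussian.exists_integrable_exp_sq (stdGaussian E)
  refine (hint.const_mul (Real.exp (t ^ 2 / (4 * C)))).mono' (by fun_prop) ?_
  refine Filter.Eventually.of_forall fun x => ?_
  rw [Real.norm_of_nonneg (Real.exp_pos _).le, ← Real.exp_add, Real.exp_le_exp]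
  have h1 : 0 ≤ (2 * C * ‖x‖ - t) ^ 2 / (4 * C) := by positivity
  have h2 : (2 * C * ‖x‖ - t) ^ 2 / (4 * C) = C * ‖x‖ ^ 2 - t * ‖x‖ + t ^ 2 / (4 * C) := by
    field_simp; ring
  linarith

theorem map_strongDual_stdGaussian (L : StrongDual ℝ E) :
    (stdGaussian E).map L = gaussianReal 0 (‖L‖ ^ 2).toNNReal := by
  rw [IsGaussian.map_eq_gaussianReal, integral_strongDual_stdGaussian, variance_dual_stdGaussian]

theorem lintegral_exp_strongDual_stdGaussian (L : StrongDual ℝ E) :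
    ∫⁻ x, ENNReal.ofReal (Real.exp (L x)) ∂(stdGaussian E)
      = ENNReal.ofReal (Real.exp (‖L‖ ^ 2 / 2)) := by
  have h := mgf_gaussianReal (map_strongDual_stdGaussian L) 1
  rw [mgf] at h
  simp only [one_mul, mul_one, zero_add, one_pow] at h
  rw [Real.coe_toNNReal _ (by positivity)] at h
  rw [← h, ofReal_integral_eq_lintegral_ofReal]
  · refine (integrable_exp_mul_norm_stdGaussian (E := E) ‖L‖).mono' (by fun_prop) ?_
    refine Filter.Eventually.of_forall fun x => ?_
    rw [Real.norm_of_nonneg (Real.exp_pos _).le, Real.exp_le_exp]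
    exact (le_abs_self _).trans (L.le_opNorm x)
  · exact Filter.Eventually.of_forall fun x => (Real.exp_pos _).le

/-- `G` is a supremum of continuous linear functionals of norm at most `ℓ`. -/
def IsSupOfDuals (G : E → ℝ) (ℓ : ℝ) : Prop :=
  ∀ x : E, ∀ η : ℝ, 0 < η →
    ∃ L : StrongDual ℝ E, ‖L‖ ≤ ℓ ∧ G x - η ≤ L x ∧ ∀ y, L y ≤ G y

theorem exp_mul_le_one_add {s z : ℝ} (hs : 0 ≤ s) (hs1 : s ≤ 1) :
    Real.exp (s * z) ≤ 1 + s * Real.exp z := by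
  have h := convexOn_exp.2 (Set.mem_univ z) (Set.mem_univ 0) hs (sub_nonneg.2 hs1) (by ring)
  simp only [smul_eq_mul, mul_zero, add_zero, Real.exp_zero, mul_one] at h
  linarith

theorem exp_sum_range_le (m : ℕ) (hm : 0 < m) (a : ℕ → ℝ) :
    Real.exp (∑ k ∈ Finset.range m, a k)
      ≤ ∑ k ∈ Finset.range m, (1 / m : ℝ) * Real.exp (m * a k) := by
  have hm' : (m : ℝ) ≠ 0 := by positivity
  have h := convexOn_exp.map_sum_le (t := Finset.range m) (w := fun _ => (1 / m : ℝ))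
    (p := fun k => m * a k) (fun _ _ => by positivity)
    (by simp [hm']) (fun _ _ => Set.mem_univ _)
  simp only [smul_eq_mul] at h
  refine le_of_eq_of_le (congrArg _ (Finset.sum_congr rfl fun k _ => ?_)) h
  field_simp

/-- One rotation step: the conditional exponential moment of the increment of `G`. -/
theorem lintegral_exp_increment_le {G : E → ℝ} {ℓ : ℝ} (hℓ : 0 ≤ ℓ) (hG : IsSupOfDuals G ℓ)
    {l : ℝ} (hl : 0 ≤ l) (m : ℕ) (hm : 2 ≤ m) (x : E) :
    ∫⁻ y, ENNReal.ofReal (Real.exp (m * (l * (G x -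
        G (Real.cos (Real.pi / 2 / m) • x + Real.sin (Real.pi / 2 / m) • y))))) ∂(stdGaussian E)
      ≤ ENNReal.ofReal (Real.exp (l ^ 2 * ℓ ^ 2 * Real.pi ^ 2 / 8)) *
        ENNReal.ofReal (1 + 2 / m * Real.exp (l + l * ℓ * ‖x‖)) := by
  have hm0 : (0 : ℝ) < m := by positivity
  have hm2 : (2 : ℝ) ≤ m := by exact_mod_cast hm
  set δ : ℝ := Real.pi / 2 / m with hδ
  have hδ0 : 0 ≤ δ := by positivity
  obtain ⟨L, hL, hLx, hLy⟩ := hG x (1 / m ^ 2) (by positivity)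
  have hsin : (m * Real.sin δ) ^ 2 ≤ Real.pi ^ 2 / 4 := by
    have h1 : |m * Real.sin δ| ≤ Real.pi / 2 := by
      rw [abs_mul, abs_of_pos hm0]
      calc m * |Real.sin δ| ≤ m * |δ| := mul_le_mul_of_nonneg_left Real.abs_sin_le_abs hm0.le
        _ = Real.pi / 2 := by rw [abs_of_nonneg hδ0, hδ]; field_simp
    rw [← sq_abs]
    calc |m * Real.sin δ| ^ 2 ≤ (Real.pi / 2) ^ 2 := by gcongr
      _ = _ := by ring
  have hcos : m * (1 - Real.cos δ) ≤ 2 / m := by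
    have h1 := Real.one_sub_sq_div_two_le_cos (x := δ)
    have hpi := Real.pi_lt_four
    have hpi0 := Real.pi_pos
    calc m * (1 - Real.cos δ) ≤ m * (δ ^ 2 / 2) := by gcongr; linarith
      _ = (Real.pi ^ 2 / 8) / m := by rw [hδ]; field_simp; ring
      _ ≤ 2 / m := by gcongr; nlinarith
  have hcos0 : 0 ≤ 1 - Real.cos δ := by linarith [Real.cos_le_one δ]
  have key : ∀ y, Real.exp (m * (l * (G x - G (Real.cos δ • x + Real.sin δ • y))))
      ≤ Real.exp (2 / m * (l + l * ℓ * ‖x‖)) * Real.exp ((-(m * l * Real.sin δ) • L) y) := by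
    intro y
    rw [← Real.exp_add, Real.exp_le_exp]
    have h1 := hLy (Real.cos δ • x + Real.sin δ • y)
    simp only [map_add, map_smul, smul_eq_mul] at h1
    have h2 : G x - G (Real.cos δ • x + Real.sin δ • y)
        ≤ 1 / m ^ 2 + (1 - Real.cos δ) * L x - Real.sin δ * L y := by linarith
    have h3 : L x ≤ ℓ * ‖x‖ := (le_abs_self _).trans
      ((L.le_opNorm x).trans (by gcongr))
    have h4 : m * (l * (1 - Real.cos δ) * L x) ≤ 2 / m * (l * ℓ * ‖x‖) := by
      calc m * (l * (1 - Real.cos δ) * L x) = (m * (1 - Real.cos δ)) * (l * L x) := by ring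
        _ ≤ (m * (1 - Real.cos δ)) * (l * (ℓ * ‖x‖)) := by gcongr
        _ ≤ 2 / m * (l * (ℓ * ‖x‖)) := by gcongr
        _ = _ := by ring
    have h5 : (m : ℝ) * (l * (1 / m ^ 2)) ≤ 2 / m * l := by
      have : (m : ℝ) * (l * (1 / m ^ 2)) = 1 / m * l := by field_simp
      rw [this]; gcongr; norm_num
    calc m * (l * (G x - G (Real.cos δ • x + Real.sin δ • y)))
        ≤ m * (l * (1 / m ^ 2 + (1 - Real.cos δ) * L x - Real.sin δ * L y)) := by gcongr
      _ = m * (l * (1 / m ^ 2)) + m * (l * (1 - Real.cos δ) * L x)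
          - m * l * Real.sin δ * L y := by ring
      _ ≤ 2 / m * l + 2 / m * (l * ℓ * ‖x‖) - m * l * Real.sin δ * L y := by gcongr
      _ = _ := by
        simp only [_root_.smul_apply, smul_eq_mul]
        ring
  calc _ ≤ ∫⁻ y, ENNReal.ofReal (Real.exp (2 / m * (l + l * ℓ * ‖x‖))) *
        ENNReal.ofReal (Real.exp ((-(m * l * Real.sin δ) • L) y)) ∂(stdGaussian E) := by
        refine lintegral_mono fun y => ?_
        rw [← ENNReal.ofReal_mul (Real.exp_pos _).le]
        exact ENNReal.ofReal_le_ofReal (key y)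
    _ = ENNReal.ofReal (Real.exp (2 / m * (l + l * ℓ * ‖x‖))) *
        ENNReal.ofReal (Real.exp (‖(-(m * l * Real.sin δ) • L)‖ ^ 2 / 2)) := by
        rw [lintegral_const_mul _ (by fun_prop), lintegral_exp_strongDual_stdGaussian]
    _ ≤ _ := by
        rw [mul_comm]
        refine mul_le_mul' (ENNReal.ofReal_le_ofReal (Real.exp_le_exp.2 ?_))
          (ENNReal.ofReal_le_ofReal ?_)
        · rw [norm_smul, Real.norm_eq_abs, abs_neg, mul_pow, sq_abs]
          calc (m * l * Real.sin δ) ^ 2 * ‖L‖ ^ 2 / 2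
              = l ^ 2 * ‖L‖ ^ 2 * (m * Real.sin δ) ^ 2 / 2 := by ring
            _ ≤ l ^ 2 * ℓ ^ 2 * (Real.pi ^ 2 / 4) / 2 := by gcongr
            _ = _ := by ring
        · exact exp_mul_le_one_add (by positivity) (by rw [div_le_one hm0]; exact hm2)

theorem lintegral_rotation_stdGaussian (θ : ℝ) {f : E × E → ENNReal} (hf : Measurable f) :
    ∫⁻ p, f (ContinuousLinearMap.rotation θ p) ∂((stdGaussian E).prod (stdGaussian E))
      = ∫⁻ p, f p ∂((stdGaussian E).prod (stdGaussian E)) := by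
  conv_rhs => rw [← IsGaussian.map_rotation_eq_self (μ := stdGaussian E) (by simp) θ]
  rw [lintegral_map hf (by fun_prop)]

/-- Gaussian concentration (exponential moment form) for a supremum of linear functionals. -/
theorem lintegral_exp_sub_le {G : E → ℝ} (hGm : Measurable G) {ℓ : ℝ} (hℓ : 0 ≤ ℓ)
    (hG : IsSupOfDuals G ℓ) {l : ℝ} (hl : 0 ≤ l) :
    ∫⁻ p, ENNReal.ofReal (Real.exp (l * (G p.1 - G p.2)))
        ∂((stdGaussian E).prod (stdGaussian E))
      ≤ ENNReal.ofReal (Real.exp (l ^ 2 * ℓ ^ 2 * Real.pi ^ 2 / 8)) := by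
  set A : ℝ := ∫ x : E, Real.exp (l + l * ℓ * ‖x‖) ∂(stdGaussian E) with hA
  have hAint : Integrable (fun x : E => Real.exp (l + l * ℓ * ‖x‖)) (stdGaussian E) := by
    simp_rw [Real.exp_add]
    exact (integrable_exp_mul_norm_stdGaussian (l * ℓ)).const_mul _
  have hbound : ∀ m : ℕ, 2 ≤ m →
      ∫⁻ p, ENNReal.ofReal (Real.exp (l * (G p.1 - G p.2)))
        ∂((stdGaussian E).prod (stdGaussian E))
      ≤ ENNReal.ofReal (Real.exp (l ^ 2 * ℓ ^ 2 * Real.pi ^ 2 / 8) * (1 + 2 / m * A)) := by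
    intro m hm
    have hm0 : (0 : ℝ) < m := by positivity
    set δ : ℝ := Real.pi / 2 / m with hδ
    let f : E × E → ENNReal := fun p => ENNReal.ofReal (Real.exp (m * (l * (G p.1 -
        G (Real.cos δ • p.1 + Real.sin δ • p.2)))))
    have hf : Measurable f := by fun_prop
    have hfint : ∫⁻ p, f p ∂((stdGaussian E).prod (stdGaussian E)) ≤
        ENNReal.ofReal (Real.exp (l ^ 2 * ℓ ^ 2 * Real.pi ^ 2 / 8) * (1 + 2 / m * A)) := by
      rw [lintegral_prod _ hf.aemeasurable]
      refine (lintegral_mono fun x => lintegral_exp_increment_le hℓ hG hl m hm x).trans ?_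
      rw [lintegral_const_mul _ (by fun_prop), ENNReal.ofReal_mul (Real.exp_pos _).le]
      gcongr
      rw [← ofReal_integral_eq_lintegral_ofReal, integral_add (integrable_const _)
        (hAint.const_mul _), integral_const_mul]
      · simp [hA]
      · exact (integrable_const _).add (hAint.const_mul _)
      · exact Filter.Eventually.of_forall fun x => by positivity
    have hpt : ∀ p : E × E, ENNReal.ofReal (Real.exp (l * (G p.1 - G p.2))) ≤
        ∑ k ∈ Finset.range m, ENNReal.ofReal (1 / m : ℝ) *
          f (ContinuousLinearMap.rotation (k * δ) p) := by
      intro p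
      have htel : l * (G p.1 - G p.2) = ∑ k ∈ Finset.range m,
          l * (G (ContinuousLinearMap.rotation (k * δ) p).1 -
            G (ContinuousLinearMap.rotation ((k + 1 : ℕ) * δ) p).1) := by
        rw [← Finset.mul_sum, Finset.sum_range_sub'
          (fun k : ℕ => G (ContinuousLinearMap.rotation (k * δ) p).1)]
        have : (m : ℝ) * δ = Real.pi / 2 := by rw [hδ]; field_simp
        simp [ContinuousLinearMap.rotation_apply, this]
      have hstep : ∀ k : ℕ, f (ContinuousLinearMap.rotation (k * δ) p) = ENNReal.ofReal
          (Real.exp (m * (l * (G (ContinuousLinearMap.rotation (k * δ) p).1 -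
            G (ContinuousLinearMap.rotation ((k + 1 : ℕ) * δ) p).1)))) := by
        intro k
        have : Real.cos δ • (ContinuousLinearMap.rotation (k * δ) p).1 +
            Real.sin δ • (ContinuousLinearMap.rotation (k * δ) p).2 =
            (ContinuousLinearMap.rotation ((k + 1 : ℕ) * δ) p).1 := by
          simp only [ContinuousLinearMap.rotation_apply]
          have h1 : ((k + 1 : ℕ) : ℝ) * δ = k * δ + δ := by push_cast; ring
          rw [h1, Real.cos_add, Real.sin_add]
          module
        simp only [f, this]
      simp_rw [hstep, ← ENNReal.ofReal_mul (show (0 : ℝ) ≤ 1 / m by positivity)]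
      rw [← ENNReal.ofReal_sum_of_nonneg (fun k _ => by positivity), htel]
      exact ENNReal.ofReal_le_ofReal (exp_sum_range_le m (by omega) _)
    calc _ ≤ ∫⁻ p, ∑ k ∈ Finset.range m, ENNReal.ofReal (1 / m : ℝ) *
          f (ContinuousLinearMap.rotation (k * δ) p)
          ∂((stdGaussian E).prod (stdGaussian E)) := lintegral_mono hpt
      _ = ∑ k ∈ Finset.range m, ENNReal.ofReal (1 / m : ℝ) *
          ∫⁻ p, f p ∂((stdGaussian E).prod (stdGaussian E)) := by
          rw [lintegral_finsetSum _ (fun k _ => by fun_prop)]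
          refine Finset.sum_congr rfl fun k _ => ?_
          rw [lintegral_const_mul _ (by fun_prop), lintegral_rotation_stdGaussian _ hf]
      _ = ∫⁻ p, f p ∂((stdGaussian E).prod (stdGaussian E)) := by
          rw [Finset.sum_const, Finset.card_range, nsmul_eq_mul, ← mul_assoc,
            ← ENNReal.ofReal_natCast, ← ENNReal.ofReal_mul (by positivity)]
          rw [mul_one_div_cancel hm0.ne', ENNReal.ofReal_one, one_mul]
      _ ≤ _ := hfint
  have hlim : Filter.Tendsto (fun m : ℕ => ENNReal.ofReal
      (Real.exp (l ^ 2 * ℓ ^ 2 * Real.pi ^ 2 / 8) * (1 + 2 / m * A))) Filter.atTop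
      (nhds (ENNReal.ofReal (Real.exp (l ^ 2 * ℓ ^ 2 * Real.pi ^ 2 / 8) * (1 + 0 * A)))) := by
    refine ENNReal.tendsto_ofReal (Filter.Tendsto.const_mul _ (Filter.Tendsto.const_add _
      (Filter.Tendsto.mul_const _ ?_)))
    exact tendsto_const_div_atTop_nhds_zero_nat 2
  have := ge_of_tendsto hlim (Filter.eventually_atTop.2 ⟨2, hbound⟩)
  simpa using this

end Gaussian

section Sphere

open ProbabilityTheory

variable {E : Type*} [NormedAddCommGroup E] [InnerProductSpace ℝ E] [FiniteDimensional ℝ E]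
  [MeasurableSpace E] [BorelSpace E]

theorem integrable_norm_stdGaussian : Integrable (fun x : E => ‖x‖) (stdGaussian E) :=
  (IsGaussian.integrable_id (μ := stdGaussian E)).norm

theorem integral_cos_gaussianReal :
    ∫ x, Real.cos x ∂(gaussianReal 0 1) = Real.exp (-(1 / 2)) := by
  have h := charFun_gaussianReal (μ := 0) (v := 1) 1
  rw [charFun_apply_real] at h
  have h2 := congrArg Complex.re h
  have hint : Integrable (fun x : ℝ => Complex.exp ((1 : ℝ) * x * Complex.I))
      (gaussianReal 0 1) := by
    refine (integrable_const (1 : ℝ)).mono' (by fun_prop) ?_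
    refine Filter.Eventually.of_forall fun x => ?_
    rw [← Complex.ofReal_mul, Complex.norm_exp_ofReal_mul_I]
  have h3 := integral_re hint
  simp only [RCLike.re_eq_complex_re] at h3
  rw [← h3] at h2
  have h4 : ∀ x : ℝ, (Complex.exp ((1 : ℝ) * x * Complex.I)).re = Real.cos x := by
    intro x
    rw [← Complex.ofReal_mul, Complex.exp_ofReal_mul_I_re, one_mul]
  simp_rw [h4] at h2
  rw [h2]
  have h5 : (((1 : ℝ) : ℂ) * ((0 : ℝ) : ℂ) * Complex.I
      - ((1 : NNReal) : ℝ) * ((1 : ℝ) : ℂ) ^ 2 / 2) = ((-(1 / 2) : ℝ) : ℂ) := by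
    push_cast; ring
  rw [h5, Complex.exp_ofReal_re]

theorem one_sub_cos_le_abs (x : ℝ) : 1 - Real.cos x ≤ |x| := by
  rcases le_or_gt |x| 2 with h | h
  · have := Real.one_sub_sq_div_two_le_cos (x := x)
    have h0 := abs_nonneg x
    rw [← sq_abs] at this
    nlinarith
  · linarith [Real.neg_one_le_cos x]

theorem integral_abs_inner_stdGaussian_ge {u : E} (hu : ‖u‖ = 1) :
    (3 / 10 : ℝ) ≤ ∫ x, |inner ℝ u x| ∂(stdGaussian E) := by
  have hmap : (stdGaussian E).map (innerSL ℝ u) = gaussianReal 0 1 := by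
    rw [map_strongDual_stdGaussian, innerSL_apply_norm, hu]; simp
  have h1 : ∫ x, |inner ℝ u x| ∂(stdGaussian E) = ∫ y, |y| ∂(gaussianReal 0 1) := by
    rw [← hmap, integral_map (by fun_prop) (by fun_prop)]
    rfl
  have hint : Integrable (fun y : ℝ => |y|) (gaussianReal 0 1) :=
    (IsGaussian.integrable_id (μ := gaussianReal 0 1)).abs
  have hcos : Integrable (fun y : ℝ => Real.cos y) (gaussianReal 0 1) :=
    (integrable_const (1 : ℝ)).mono' (by fun_prop)
      (Filter.Eventually.of_forall fun y => by simpa using Real.abs_cos_le_one y)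
  have h2 : ∫ y, (1 - Real.cos y) ∂(gaussianReal 0 1) ≤ ∫ y, |y| ∂(gaussianReal 0 1) :=
    integral_mono ((integrable_const _).sub hcos) hint one_sub_cos_le_abs
  rw [integral_sub (integrable_const _) hcos, integral_cos_gaussianReal] at h2
  have h3 : Real.exp (-(1 / 2)) ≤ 7 / 10 := by
    rw [Real.exp_neg]
    have : (1 + 1 / 2 : ℝ) ≤ Real.exp (1 / 2) := by
      linarith [Real.add_one_le_exp (1 / 2 : ℝ)]
    calc (Real.exp (1 / 2))⁻¹ ≤ (1 + 1 / 2 : ℝ)⁻¹ := by gcongr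
      _ ≤ 7 / 10 := by norm_num
  rw [h1]
  simp at h2
  linarith

theorem integral_norm_stdGaussian_ge :
    (3 / 10 : ℝ) * Real.sqrt (Module.finrank ℝ E) ≤ ∫ x, ‖x‖ ∂(stdGaussian E) := by
  set n := Module.finrank ℝ E
  let b := stdOrthonormalBasis ℝ E
  have hpt : ∀ x : E, ∑ i, |inner ℝ (b i) x| ≤ Real.sqrt n * ‖x‖ := by
    intro x
    refine Real.le_sqrt_of_sq_le ?_ |>.trans (le_of_eq ?_) (b := Real.sqrt (n * ‖x‖ ^ 2))
    · refine (sq_sum_le_card_mul_sum_sq).trans (le_of_eq ?_)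
      simp only [sq_abs, Finset.card_univ, Fintype.card_fin]
      rw [b.sum_sq_inner_right]
    · rw [Real.sqrt_mul (by positivity), Real.sqrt_sq (norm_nonneg _)]
  have hint : ∀ i, Integrable (fun x => |inner ℝ (b i) x|) (stdGaussian E) := fun i =>
    (integrable_norm_stdGaussian (E := E)).mono' (by fun_prop)
      (Filter.Eventually.of_forall fun x => by
        rw [Real.norm_eq_abs, abs_abs]
        simpa using abs_real_inner_le_norm (b i) x)
  have h1 : ∫ x, ∑ i, |inner ℝ (b i) x| ∂(stdGaussian E) ≤
      ∫ x, Real.sqrt n * ‖x‖ ∂(stdGaussian E) :=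
    integral_mono (integrable_finsetSum _ fun i _ => hint i)
      (integrable_norm_stdGaussian.const_mul _) hpt
  rw [integral_finsetSum _ fun i _ => hint i, integral_const_mul] at h1
  have h2 : (n : ℝ) * (3 / 10) ≤ ∑ i, ∫ x, |inner ℝ (b i) x| ∂(stdGaussian E) := by
    calc (n : ℝ) * (3 / 10) = ∑ _i : Fin n, (3 / 10 : ℝ) := by simp
      _ ≤ _ := Finset.sum_le_sum fun i _ =>
        integral_abs_inner_stdGaussian_ge (b.orthonormal.1 i)
  rcases Nat.eq_zero_or_pos n with h0 | h0
  · rw [h0]; simp only [Nat.cast_zero, Real.sqrt_zero, mul_zero]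
    exact integral_nonneg fun x => norm_nonneg x
  · have hs : 0 < Real.sqrt n := Real.sqrt_pos.2 (by exact_mod_cast h0)
    have h3 := h2.trans h1
    have h4 : Real.sqrt n * (Real.sqrt n * (3 / 10)) ≤
        Real.sqrt n * ∫ x, ‖x‖ ∂(stdGaussian E) := by
      rw [← mul_assoc, Real.mul_self_sqrt (Nat.cast_nonneg n)]; exact h3
    rw [mul_comm]
    exact le_of_mul_le_mul_left h4 hs

theorem ofReal_exp_integral_le {Ω : Type*} [MeasurableSpace Ω] (P : Measure Ω)
    [IsProbabilityMeasure P] {Z : Ω → ℝ} (hZ : Integrable Z P) :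
    ENNReal.ofReal (Real.exp (∫ x, Z x ∂P)) ≤ ∫⁻ x, ENNReal.ofReal (Real.exp (Z x)) ∂P := by
  have hm : AEStronglyMeasurable (fun x => Real.exp (Z x)) P :=
    Real.continuous_exp.comp_aestronglyMeasurable hZ.aestronglyMeasurable
  have hnn : 0 ≤ᵐ[P] fun x => Real.exp (Z x) :=
    Filter.Eventually.of_forall fun x => (Real.exp_pos _).le
  by_cases h : Integrable (fun x => Real.exp (Z x)) P
  · rw [← ofReal_integral_eq_lintegral_ofReal h hnn]
    exact ENNReal.ofReal_le_ofReal (convexOn_exp.map_integral_le Real.continuous_exp.continuousOn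
      isClosed_univ (Filter.Eventually.of_forall fun _ => Set.mem_univ _) hZ h)
  · have : ∫⁻ x, ENNReal.ofReal (Real.exp (Z x)) ∂P = ⊤ := by
      by_contra hne
      exact h ⟨hm, (hasFiniteIntegral_iff_ofReal hnn).2 (lt_top_iff_ne_top.2 hne)⟩
    rw [this]; exact le_top

/-- `ν` is the angular part in a polar decomposition of the standard Gaussian measure. -/
def IsGaussianAngularPart (ν : Measure E) : Prop :=
  stdGaussian E = ((stdGaussian E).prod ν).map (fun p => ‖p.1‖ • p.2)

theorem IsGaussianAngularPart.lintegral_eq {ν : Measure E} [SFinite ν]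
    (hν : IsGaussianAngularPart ν)
    {f : E → ENNReal} (hf : Measurable f) :
    ∫⁻ x, f x ∂(stdGaussian E) = ∫⁻ φ, ∫⁻ g, f (‖g‖ • φ) ∂(stdGaussian E) ∂ν := by
  have hm : Measurable (fun p : E × E => ‖p.1‖ • p.2) := by fun_prop
  conv_lhs => rw [hν]
  rw [lintegral_map hf hm]
  exact lintegral_prod_symm _ (hf.comp hm).aemeasurable

theorem lintegral_exp_angular_le {ν : Measure E} [IsProbabilityMeasure ν]
    (hν : IsGaussianAngularPart ν) {G : E → ℝ} (hGm : Measurable G) {ℓ : ℝ} (hℓ : 0 ≤ ℓ)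
    (hG : IsSupOfDuals G ℓ) (hhom : ∀ (r : ℝ) (x : E), 0 ≤ r → G (r • x) = r * G x)
    (hGint : Integrable G ν) {l : ℝ} (hl : 0 ≤ l) :
    ∫⁻ φ, ENNReal.ofReal (Real.exp (l * (∫ x : E, ‖x‖ ∂(stdGaussian E)) *
        (G φ - ∫ x, G x ∂ν))) ∂ν
      ≤ ENNReal.ofReal (Real.exp (l ^ 2 * ℓ ^ 2 * Real.pi ^ 2 / 8)) := by
  refine le_trans ?_ (lintegral_exp_sub_le hGm hℓ hG hl)
  set c := ∫ x : E, ‖x‖ ∂(stdGaussian E) with hc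
  set M := ∫ x, G x ∂ν with hM
  have hn : Integrable (fun x : E => ‖x‖) (stdGaussian E) := integrable_norm_stdGaussian
  have hmeas : Measurable (fun p : E × E => ENNReal.ofReal (Real.exp (l * (G p.1 - G p.2)))) := by
    fun_prop
  rw [lintegral_prod _ hmeas.aemeasurable, hν.lintegral_eq hmeas.lintegral_prod_right']
  refine lintegral_mono fun φ => ?_
  have h1 : ∀ g : E, ENNReal.ofReal (Real.exp (l * (‖g‖ * G φ - c * M))) ≤
      ∫⁻ y, ENNReal.ofReal (Real.exp (l * (G (‖g‖ • φ) - G y))) ∂(stdGaussian E) := by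
    intro g
    rw [hν.lintegral_eq (by fun_prop)]
    have h2 : ∀ φ' : E, ENNReal.ofReal (Real.exp (l * (‖g‖ * G φ - c * G φ'))) ≤
        ∫⁻ g' : E, ENNReal.ofReal (Real.exp (l * (G (‖g‖ • φ) - G (‖g'‖ • φ'))))
          ∂(stdGaussian E) := by
      intro φ'
      have h3 := ofReal_exp_integral_le (stdGaussian E)
        (Z := fun g' : E => l * (‖g‖ * G φ - ‖g'‖ * G φ'))
        (((integrable_const _).sub (hn.mul_const _)).const_mul _)
      rw [integral_const_mul, integral_sub (integrable_const _) (hn.mul_const _),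
        integral_const, integral_mul_const, ← hc] at h3
      simpa [hhom] using h3
    refine le_trans ?_ (lintegral_mono h2)
    have h3 := ofReal_exp_integral_le ν (Z := fun φ' : E => l * (‖g‖ * G φ - c * G φ'))
      (((integrable_const _).sub (hGint.const_mul _)).const_mul _)
    rw [integral_const_mul, integral_sub (integrable_const _) (hGint.const_mul _),
      integral_const, integral_const_mul, ← hM] at h3
    simpa using h3
  refine le_trans ?_ (lintegral_mono h1)
  have h3 := ofReal_exp_integral_le (stdGaussian E) (Z := fun g : E => l * (‖g‖ * G φ - c * M))
    (((hn.mul_const _).sub (integrable_const _)).const_mul _)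
  rw [integral_const_mul, integral_sub (hn.mul_const _) (integrable_const _),
    integral_mul_const, ← hc] at h3
  simpa [mul_sub, mul_assoc] using h3

theorem measure_angular_ge_le {ν : Measure E} [IsProbabilityMeasure ν]
    (hν : IsGaussianAngularPart ν) {G : E → ℝ} (hGm : Measurable G) {ℓ : ℝ} (hℓ : 0 < ℓ)
    (hG : IsSupOfDuals G ℓ) (hhom : ∀ (r : ℝ) (x : E), 0 ≤ r → G (r • x) = r * G x)
    (hGint : Integrable G ν) {s : ℝ} (hs : 0 ≤ s) :
    ν {φ | (∫ x, G x ∂ν) + s ≤ G φ} ≤ ENNReal.ofReal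
      (Real.exp (-(9 / 50 * Module.finrank ℝ E * s ^ 2 / (ℓ ^ 2 * Real.pi ^ 2)))) := by
  set c := ∫ x : E, ‖x‖ ∂(stdGaussian E) with hc
  set M := ∫ x, G x ∂ν with hM
  have hc0 : 0 ≤ c := integral_nonneg fun x => norm_nonneg x
  have hc2 : 9 / 100 * (Module.finrank ℝ E : ℝ) ≤ c ^ 2 := by
    calc 9 / 100 * (Module.finrank ℝ E : ℝ)
        = ((3 / 10 : ℝ) * Real.sqrt (Module.finrank ℝ E)) ^ 2 := by
          rw [mul_pow, Real.sq_sqrt (by positivity)]; norm_num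
      _ ≤ c ^ 2 := by gcongr; exact integral_norm_stdGaussian_ge
  have hpi := Real.pi_pos
  set l : ℝ := 4 * c * s / (ℓ ^ 2 * Real.pi ^ 2) with hl
  have hl0 : 0 ≤ l := by positivity
  have h1 := lintegral_exp_angular_le hν hGm hℓ.le hG hhom hGint hl0
  rw [← hc, ← hM] at h1
  have h2 := mul_meas_ge_le_lintegral (μ := ν)
    (f := fun φ => ENNReal.ofReal (Real.exp (l * c * (G φ - M)))) (by fun_prop)
    (ENNReal.ofReal (Real.exp (l * c * s)))
  have h3 : ν {φ | M + s ≤ G φ} ≤ ν {φ | ENNReal.ofReal (Real.exp (l * c * s)) ≤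
      ENNReal.ofReal (Real.exp (l * c * (G φ - M)))} := by
    refine measure_mono fun φ hφ => ENNReal.ofReal_le_ofReal (Real.exp_le_exp.2 ?_)
    simp only [Set.mem_ofPred_eq] at hφ
    gcongr
    linarith
  have h4 : ENNReal.ofReal (Real.exp (l * c * s)) * ν {φ | M + s ≤ G φ} ≤
      ENNReal.ofReal (Real.exp (l ^ 2 * ℓ ^ 2 * Real.pi ^ 2 / 8)) :=
    (mul_le_mul_right h3 _).trans (h2.trans h1)
  have h5 : ν {φ | M + s ≤ G φ} = ENNReal.ofReal (Real.exp (-(l * c * s))) *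
      (ENNReal.ofReal (Real.exp (l * c * s)) * ν {φ | M + s ≤ G φ}) := by
    rw [← mul_assoc, ← ENNReal.ofReal_mul (Real.exp_pos _).le, ← Real.exp_add]
    simp
  rw [h5]
  refine (mul_le_mul_right h4 _).trans ?_
  rw [← ENNReal.ofReal_mul (Real.exp_pos _).le, ← Real.exp_add]
  refine ENNReal.ofReal_le_ofReal (Real.exp_le_exp.2 ?_)
  have h6 : -(l * c * s) + l ^ 2 * ℓ ^ 2 * Real.pi ^ 2 / 8 =
      -(2 * c ^ 2 * s ^ 2 / (ℓ ^ 2 * Real.pi ^ 2)) := by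
    rw [hl]; field_simp; ring
  rw [h6, neg_le_neg_iff]
  exact div_le_div_of_nonneg_right (mul_le_mul_of_nonneg_right (by linarith) (sq_nonneg s))
    (by positivity)

end Sphere

section UnitaryAction

open ProbabilityTheory

variable {n : Type*} [Fintype n] [DecidableEq n]

/-- The action of a matrix on Euclidean space. -/
abbrev mulVecE (A : Matrix n n ℂ) : EuclideanSpace ℂ n →L[ℂ] EuclideanSpace ℂ n :=
  Matrix.toEuclideanCLM (𝕜 := ℂ) A

theorem mulVecE_apply (A : Matrix n n ℂ) (x : EuclideanSpace ℂ n) (i : n) :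
    mulVecE A x i = ∑ j, A i j * x j := by
  rw [mulVecE, Matrix.ofLp_toEuclideanCLM]; rfl

theorem mulVecE_eq_toLp (A : Matrix n n ℂ) (x : EuclideanSpace ℂ n) :
    mulVecE A x = WithLp.toLp 2 fun i => ∑ j, A i j * x j := by
  ext i; exact mulVecE_apply A x i

theorem mulVecE_mul (A B : Matrix n n ℂ) (x : EuclideanSpace ℂ n) :
    mulVecE (A * B) x = mulVecE A (mulVecE B x) := by
  simp [mulVecE, map_mul]

/-- The linear isometry given by a unitary matrix. -/
def unitaryIsometry {W : Matrix n n ℂ} (hW : W ∈ unitaryGroup n ℂ) :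
    EuclideanSpace ℂ n ≃ₗᵢ[ℂ] EuclideanSpace ℂ n :=
  Unitary.linearIsometryEquiv ⟨mulVecE W, Unitary.map_mem (Matrix.toEuclideanCLM (𝕜 := ℂ)) hW⟩

theorem norm_mulVecE_of_mem {W : Matrix n n ℂ} (hW : W ∈ unitaryGroup n ℂ)
    (x : EuclideanSpace ℂ n) : ‖mulVecE W x‖ = ‖x‖ :=
  (unitaryIsometry hW).norm_map x

theorem map_mulVecE_stdGaussian {W : Matrix n n ℂ} (hW : W ∈ unitaryGroup n ℂ) :
    (stdGaussian (EuclideanSpace ℂ n)).map (mulVecE W) = stdGaussian (EuclideanSpace ℂ n) :=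
  stdGaussian_map ({ toLinearEquiv := (unitaryIsometry hW).toLinearEquiv.restrictScalars ℝ
                     norm_map' := (unitaryIsometry hW).norm_map } :
    EuclideanSpace ℂ n ≃ₗᵢ[ℝ] EuclideanSpace ℂ n)

theorem measurable_specialUnitary_entry (i j : n) :
    Measurable (fun U : specialUnitaryGroup n ℂ => U.1 i j) :=
  (measurable_pi_apply j).comp ((measurable_pi_apply i).comp measurable_subtype_coe)

theorem measurable_to_specialUnitary {α : Type*} [MeasurableSpace α]
    {f : α → specialUnitaryGroup n ℂ} (hf : ∀ i j, Measurable fun a => (f a).1 i j) :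
    Measurable f :=
  Measurable.subtype_mk (f := fun a => (f a).1)
    (measurable_pi_lambda _ fun i => measurable_pi_lambda _ fun j => hf i j)

instance : MeasurableMul₂ (specialUnitaryGroup n ℂ) where
  measurable_mul := by
    refine measurable_to_specialUnitary fun i j => ?_
    simp only [Submonoid.coe_mul, Matrix.mul_apply]
    refine Finset.measurable_sum _ fun k _ => ?_
    exact ((measurable_specialUnitary_entry i k).comp measurable_fst).mul
      ((measurable_specialUnitary_entry k j).comp measurable_snd)

instance : MeasurableInv (specialUnitaryGroup n ℂ) where
  measurable_inv := by
    refine measurable_to_specialUnitary fun i j => ?_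
    exact continuous_star.measurable.comp (measurable_specialUnitary_entry j i)

theorem measurable_mulVecE_prod :
    Measurable fun p : specialUnitaryGroup n ℂ × EuclideanSpace ℂ n => mulVecE p.1.1 p.2 := by
  simp_rw [mulVecE_eq_toLp]
  refine (WithLp.measurable_toLp 2 _).comp (measurable_pi_lambda _ fun i =>
    Finset.measurable_sum _ fun j _ => ?_)
  exact ((measurable_specialUnitary_entry i j).comp measurable_fst).mul
    ((by fun_prop : Measurable fun x : EuclideanSpace ℂ n => x j).comp measurable_snd)

theorem measurable_mulVecE_left (ψ : EuclideanSpace ℂ n) :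
    Measurable fun U : specialUnitaryGroup n ℂ => mulVecE U.1 ψ := by
  simp_rw [mulVecE_eq_toLp]
  refine (WithLp.measurable_toLp 2 _).comp (measurable_pi_lambda _ fun i =>
    Finset.measurable_sum _ fun j _ => ?_)
  exact (measurable_specialUnitary_entry i j).mul_const _

/-- The special unitary group acts transitively on the unit sphere. -/
theorem exists_specialUnitary_mulVecE_eq (hn : 2 ≤ Fintype.card n) {u v : EuclideanSpace ℂ n}
    (hu : ‖u‖ = 1) (hv : ‖v‖ = 1) :
    ∃ W : specialUnitaryGroup n ℂ, mulVecE W.1 u = v := by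
  obtain ⟨i₀, i₁, hne⟩ := Fintype.exists_pair_of_one_lt_card (α := n) hn
  have hex : ∀ w : EuclideanSpace ℂ n, ‖w‖ = 1 →
      ∃ A ∈ unitaryGroup n ℂ, mulVecE A (EuclideanSpace.single i₀ 1) = w := by
    intro w hw
    obtain ⟨b, hb⟩ := Orthonormal.exists_orthonormalBasis_extension_of_card_eq (𝕜 := ℂ)
      (E := EuclideanSpace ℂ n) (ι := n) (by simp) (v := fun _ => w) (s := {i₀})
      ⟨fun _ => hw, fun i j hij => (hij (Subsingleton.elim i j)).elim⟩
    refine ⟨_, (EuclideanSpace.basisFun n ℂ).toMatrix_orthonormalBasis_mem_unitary b, ?_⟩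
    ext i
    rw [mulVecE_apply, ← hb i₀ rfl]
    simp [Module.Basis.toMatrix_apply]
  obtain ⟨A, hA, hAu⟩ := hex u hu
  obtain ⟨B, hB, hBv⟩ := hex v hv
  set z : ℂ := star (B * star A).det with hz
  have hBA : B * star A ∈ unitaryGroup n ℂ := mul_mem hB (Unitary.star_mem hA)
  have hzz : z * star z = 1 := by
    have h := (Matrix.det_of_mem_unitary hBA)
    rw [hz, star_star]
    exact (Unitary.mem_iff.1 h).1
  set D : Matrix n n ℂ := diagonal (Function.update 1 i₁ z) with hD
  have hDu : D ∈ unitaryGroup n ℂ := by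
    rw [mem_unitaryGroup_iff, hD, star_eq_conjTranspose, diagonal_conjTranspose,
      diagonal_mul_diagonal, ← diagonal_one]
    congr 1
    funext i
    by_cases h : i = i₁
    · subst h; simpa using hzz
    · simp [h]
  have hDe : mulVecE D (EuclideanSpace.single i₀ 1) = EuclideanSpace.single i₀ 1 := by
    ext i
    rw [mulVecE_apply]
    by_cases h : i = i₀
    · subst h; simp [hD, hne]
    · simp [hD, h, diagonal_apply]
  have hdet : D.det = z := by
    rw [hD, det_diagonal, Finset.prod_update_of_mem (Finset.mem_univ _)]; simp
  refine ⟨⟨B * D * star A, mem_specialUnitaryGroup_iff.2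
    ⟨mul_mem (mul_mem hB hDu) (Unitary.star_mem hA), ?_⟩⟩, ?_⟩
  · have : (B * D * star A).det = z * (B * star A).det := by
      rw [det_mul, det_mul, det_mul, hdet]; ring
    rw [this, ← star_star (B * star A).det, ← hz, hzz]
  · change mulVecE (B * D * star A) u = v
    rw [← hAu, ← mulVecE_mul, mul_assoc, (Unitary.mem_iff.1 hA).1, mul_one, mulVecE_mul, hDe, hBv]

variable (μ : Measure (specialUnitaryGroup n ℂ)) [IsProbabilityMeasure μ] [μ.IsMulLeftInvariant]

/-- The orbit of a vector under a measure on the special unitary group. -/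
def orbitMeasure (ψ : EuclideanSpace ℂ n) : Measure (EuclideanSpace ℂ n) :=
  μ.map fun U => mulVecE U.1 ψ

instance (ψ : EuclideanSpace ℂ n) : IsProbabilityMeasure (orbitMeasure μ ψ) :=
  Measure.isProbabilityMeasure_map (measurable_mulVecE_left ψ).aemeasurable

theorem lintegral_inv_eq_of_mulLeftInvariant {f : specialUnitaryGroup n ℂ → ENNReal}
    (hf : Measurable f) : ∫⁻ U, f U⁻¹ ∂μ = ∫⁻ U, f U ∂μ := by
  have h1 : ∫⁻ W, ∫⁻ U, f (W⁻¹ * U) ∂μ ∂μ = ∫⁻ U, f U ∂μ := by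
    simp [lintegral_mul_left_eq_self]
  have h2 : ∫⁻ W, ∫⁻ U, f (W⁻¹ * U) ∂μ ∂μ = ∫⁻ U, f U⁻¹ ∂μ := by
    rw [lintegral_lintegral_swap (by fun_prop)]
    have : ∀ U, ∫⁻ W, f (W⁻¹ * U) ∂μ = ∫⁻ W, f W⁻¹ ∂μ := by
      intro U
      rw [← lintegral_mul_left_eq_self (μ := μ) (fun W => f (W⁻¹ * U)) U]
      simp [_root_.mul_inv_rev]
    simp [this]
  rw [← h2, h1]

theorem lintegral_mul_right_eq_of_mulLeftInvariant {f : specialUnitaryGroup n ℂ → ENNReal}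
    (hf : Measurable f) (V : specialUnitaryGroup n ℂ) :
    ∫⁻ U, f (U * V) ∂μ = ∫⁻ U, f U ∂μ := by
  rw [← lintegral_inv_eq_of_mulLeftInvariant μ (f := fun U => f (U * V)) (by fun_prop),
    ← lintegral_inv_eq_of_mulLeftInvariant μ hf,
    ← lintegral_mul_left_eq_self (μ := μ) (fun U => f U⁻¹) V⁻¹]
  simp

theorem isGaussianAngularPart_orbitMeasure (hn : 2 ≤ Fintype.card n) {ψ : EuclideanSpace ℂ n}
    (hψ : ‖ψ‖ = 1) : IsGaussianAngularPart (orbitMeasure μ ψ) := by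
  have hm : Measurable (fun p : EuclideanSpace ℂ n × EuclideanSpace ℂ n => ‖p.1‖ • p.2) := by
    fun_prop
  refine Measure.ext_of_lintegral _ fun f hf => ?_
  rw [lintegral_map hf hm, lintegral_prod (fun p => f (‖p.1‖ • p.2)) (hf.comp hm).aemeasurable]
  have h1 : ∀ W : specialUnitaryGroup n ℂ, ∫⁻ g, f g ∂(stdGaussian (EuclideanSpace ℂ n)) =
      ∫⁻ g, f (mulVecE W.1 g) ∂(stdGaussian (EuclideanSpace ℂ n)) := by
    intro W
    conv_lhs => rw [← map_mulVecE_stdGaussian (mem_specialUnitaryGroup_iff.1 W.2).1]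
    rw [lintegral_map hf (by fun_prop)]
  have h2 : ∫⁻ g, f g ∂(stdGaussian (EuclideanSpace ℂ n)) =
      ∫⁻ W : specialUnitaryGroup n ℂ, ∫⁻ g, f (mulVecE W.1 g)
        ∂(stdGaussian (EuclideanSpace ℂ n)) ∂μ := by
    simp_rw [← h1]; simp
  have h3 : AEMeasurable (Function.uncurry fun (W : specialUnitaryGroup n ℂ)
      (g : EuclideanSpace ℂ n) => f (mulVecE W.1 g))
      (μ.prod (stdGaussian (EuclideanSpace ℂ n))) :=
    (hf.comp measurable_mulVecE_prod).aemeasurable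
  rw [h2, lintegral_lintegral_swap h3]
  refine lintegral_congr fun g => ?_
  simp only
  rw [orbitMeasure, lintegral_map (by fun_prop) (measurable_mulVecE_left ψ)]
  rcases eq_or_ne g 0 with rfl | hg
  · simp
  · have hg' : ‖g‖ ≠ 0 := norm_ne_zero_iff.2 hg
    obtain ⟨V, hV⟩ := exists_specialUnitary_mulVecE_eq hn hψ
      (v := (‖g‖⁻¹ : ℝ) • g) (by rw [norm_smul]; simp [hg'])
    rw [← lintegral_mul_right_eq_of_mulLeftInvariant μ
      (f := fun U => f (‖g‖ • mulVecE U.1 ψ))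
      ((hf.comp (measurable_const_smul ‖g‖)).comp (measurable_mulVecE_left ψ)) V]
    refine lintegral_congr fun U => ?_
    rw [Submonoid.coe_mul, mulVecE_mul, hV]
    have : (‖g‖⁻¹ : ℝ) • g = ((‖g‖⁻¹ : ℝ) : ℂ) • g := by
      ext i; simp
    rw [this, map_smul]
    congr 1
    ext i
    have : (‖g‖ : ℂ) ≠ 0 := by exact_mod_cast hg'
    simp
    field_simp

end UnitaryAction

section SupNorm

variable {n ι : Type*} [Fintype n]
  {A : ι → EuclideanSpace ℂ n →L[ℂ] EuclideanSpace ℂ n} {ℓ : ℝ}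

/-- The supremum of the norms of the images of a vector under a family of operators. -/
def supNorm (A : ι → EuclideanSpace ℂ n →L[ℂ] EuclideanSpace ℂ n) (x : EuclideanSpace ℂ n) : ℝ :=
  ⨆ i, ‖A i x‖

theorem bddAbove_range_norm_apply (hA : ∀ i, ‖A i‖ ≤ ℓ) (x : EuclideanSpace ℂ n) :
    BddAbove (Set.range fun i => ‖A i x‖) :=
  ⟨ℓ * ‖x‖, by
    rintro _ ⟨i, rfl⟩
    exact (A i).le_of_opNorm_le (hA i) x⟩

theorem norm_apply_le_supNorm (hA : ∀ i, ‖A i‖ ≤ ℓ) (x : EuclideanSpace ℂ n) (i : ι) :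
    ‖A i x‖ ≤ supNorm A x :=
  le_ciSup (bddAbove_range_norm_apply hA x) i

theorem supNorm_nonneg (x : EuclideanSpace ℂ n) : 0 ≤ supNorm A x :=
  Real.iSup_nonneg fun _ => norm_nonneg _

theorem supNorm_le [Nonempty ι] (hA : ∀ i, ‖A i‖ ≤ ℓ) (x : EuclideanSpace ℂ n) :
    supNorm A x ≤ ℓ * ‖x‖ :=
  ciSup_le fun i => (A i).le_of_opNorm_le (hA i) x

theorem supNorm_sq_le [Nonempty ι] {x : EuclideanSpace ℂ n} {c : ℝ} (h : ∀ i, ‖A i x‖ ^ 2 ≤ c) :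
    supNorm A x ^ 2 ≤ c := by
  have hc : 0 ≤ c := (sq_nonneg _).trans (h (Classical.arbitrary ι))
  have : supNorm A x ≤ Real.sqrt c := ciSup_le fun i => Real.le_sqrt_of_sq_le (h i)
  calc supNorm A x ^ 2 ≤ Real.sqrt c ^ 2 := pow_le_pow_left₀ (supNorm_nonneg x) this 2
    _ = c := Real.sq_sqrt hc

theorem supNorm_smul (r : ℝ) (x : EuclideanSpace ℂ n) (hr : 0 ≤ r) :
    supNorm A (r • x) = r * supNorm A x := by
  rw [supNorm, supNorm, Real.mul_iSup_of_nonneg hr]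
  congr 1
  funext i
  have : r • x = (r : ℂ) • x := by ext j; simp
  rw [this, map_smul, norm_smul, Complex.norm_of_nonneg hr]

theorem continuous_supNorm [Nonempty ι] (hA : ∀ i, ‖A i‖ ≤ ℓ) (hℓ : 0 ≤ ℓ) :
    Continuous (supNorm A) := by
  have : LipschitzWith ℓ.toNNReal (supNorm A) := by
    refine LipschitzWith.of_le_add_mul _ fun x y => ciSup_le fun i => ?_
    have h1 : A i x = A i y + A i (x - y) := by rw [map_sub]; abel
    rw [h1, Real.coe_toNNReal _ hℓ, dist_eq_norm]
    exact (norm_add_le _ _).trans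
      (add_le_add (norm_apply_le_supNorm hA y i) ((A i).le_of_opNorm_le (hA i) _))
  exact this.continuous

theorem isSupOfDuals_supNorm [Nonempty ι] (hA : ∀ i, ‖A i‖ ≤ ℓ) : IsSupOfDuals (supNorm A) ℓ := by
  intro x η hη
  obtain ⟨i, hi⟩ := exists_lt_of_lt_ciSup (f := fun i => ‖A i x‖)
    (show supNorm A x - η < ⨆ i, ‖A i x‖ from sub_lt_self _ hη)
  obtain ⟨g, hg, hgx⟩ := exists_dual_vector'' ℝ (A i x)
  have hgle : ∀ y, g (A i y) ≤ ‖A i y‖ := fun y =>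
    (le_abs_self _).trans ((g.le_of_opNorm_le hg _).trans_eq (one_mul _))
  refine ⟨g.comp ((A i).restrictScalars ℝ), ?_, ?_, fun y => ?_⟩
  · refine ContinuousLinearMap.opNorm_le_bound _ ((norm_nonneg _).trans (hA i)) fun y => ?_
    exact (g.le_of_opNorm_le hg _).trans
      ((one_mul _).trans_le ((A i).le_of_opNorm_le (hA i) y))
  · change supNorm A x - η ≤ g (A i x)
    rw [hgx]
    exact hi.le
  · exact (hgle y).trans (norm_apply_le_supNorm hA y i)

end SupNorm

section Tensor

variable {d N : ℕ}

theorem tensorProd_mul (A B : Fin N → Matrix (Fin d) (Fin d) ℂ) :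
    tensorProd A * tensorProd B = tensorProd (A * B) := by
  ext x y
  simp only [tensorProd, Matrix.mul_apply, Matrix.of_apply, Pi.mul_apply]
  rw [Finset.prod_univ_sum]
  simp only [Fintype.piFinset_univ, Finset.prod_mul_distrib]

theorem star_tensorProd (A : Fin N → Matrix (Fin d) (Fin d) ℂ) :
    star (tensorProd A) = tensorProd (star A) := by
  ext x y
  simp [tensorProd, Matrix.star_apply]

theorem tensorProd_one : tensorProd (1 : Fin N → Matrix (Fin d) (Fin d) ℂ) = 1 := by
  ext x y
  simp only [tensorProd, Matrix.of_apply, Pi.one_apply, Matrix.one_apply, Finset.prod_ite_zero,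
    Finset.prod_const_one, Finset.mem_univ, true_implies, funext_iff]

theorem tensorProd_mem_unitaryGroup (V : Fin N → unitaryGroup (Fin d) ℂ) :
    (tensorProd fun j => (V j : Matrix (Fin d) (Fin d) ℂ)) ∈
      unitaryGroup (Fin N → Fin d) ℂ := by
  rw [mem_unitaryGroup_iff, star_tensorProd, tensorProd_mul, ← tensorProd_one]
  congr 1
  funext j
  exact mem_unitaryGroup_iff.1 (V j).2

/-- A one-particle matrix acting on the `k`-th tensor factor. -/
def siteMatrix (k : Fin N) (A : Matrix (Fin d) (Fin d) ℂ) :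
    Matrix (Fin N → Fin d) (Fin N → Fin d) ℂ :=
  Matrix.of fun x y => if ∀ i, i ≠ k → x i = y i then A (x k) (y k) else 0

theorem siteMatrix_eq_tensorProd (k : Fin N) (A : Matrix (Fin d) (Fin d) ℂ) :
    siteMatrix k A = tensorProd (Function.update 1 k A) := by
  ext x y
  have h1 : ∏ j ∈ Finset.univ.erase k, Function.update (1 : Fin N → Matrix (Fin d) (Fin d) ℂ) k A j
      (x j) (y j) = if ∀ i, i ≠ k → x i = y i then 1 else 0 := by
    calc _ = ∏ j ∈ Finset.univ.erase k, if x j = y j then (1 : ℂ) else 0 :=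
          Finset.prod_congr rfl fun j hj => by
            rw [Function.update_of_ne (Finset.ne_of_mem_erase hj), Pi.one_apply, Matrix.one_apply]
      _ = _ := by
          rw [Finset.prod_ite_zero]; simp
  rw [tensorProd, Matrix.of_apply, ← Finset.mul_prod_erase _ _ (Finset.mem_univ k), h1,
    Function.update_self, siteMatrix, Matrix.of_apply]
  simp

/-- The embedding of one-particle operators at site `k`. -/
def siteHom (k : Fin N) :
    Matrix (Fin d) (Fin d) ℂ →⋆ₐ[ℂ] Matrix (Fin N → Fin d) (Fin N → Fin d) ℂ where
  toFun := siteMatrix k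
  map_one' := by
    rw [siteMatrix_eq_tensorProd, ← tensorProd_one]
    congr 1
    exact Function.update_eq_self k 1
  map_mul' A B := by
    simp only [siteMatrix_eq_tensorProd, tensorProd_mul]
    congr 1
    rw [← Function.update_mul, mul_one]
  map_zero' := by ext x y; simp [siteMatrix]
  map_add' A B := by
    ext x y
    simp only [siteMatrix, Matrix.of_apply, Matrix.add_apply]
    split_ifs <;> simp
  commutes' c := by
    have h1 : siteMatrix k (1 : Matrix (Fin d) (Fin d) ℂ) = 1 := by
      rw [siteMatrix_eq_tensorProd, ← tensorProd_one]
      congr 1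
      exact Function.update_eq_self k 1
    rw [Algebra.algebraMap_eq_smul_one, Algebra.algebraMap_eq_smul_one, ← h1]
    ext x y
    simp [siteMatrix]
  map_star' A := by
    rw [siteMatrix_eq_tensorProd, siteMatrix_eq_tensorProd, star_tensorProd]
    congr 1
    funext j
    by_cases h : j = k
    · subst h; simp
    · simp [h]

theorem opNorm_siteMatrix_le (k : Fin N) (A : Matrix (Fin d) (Fin d) ℂ) :
    opNorm (siteMatrix k A) ≤ opNorm A := by
  let F : (EuclideanSpace ℂ (Fin d) →L[ℂ] EuclideanSpace ℂ (Fin d)) →⋆ₐ[ℂ]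
      (EuclideanSpace ℂ (Fin N → Fin d) →L[ℂ] EuclideanSpace ℂ (Fin N → Fin d)) :=
    (Matrix.toEuclideanCLM (n := Fin N → Fin d) (𝕜 := ℂ)).toStarAlgHom.comp
      ((siteHom k).comp
        (Matrix.toEuclideanCLM (n := Fin d) (𝕜 := ℂ)).symm.toStarAlgHom)
  have h := NonUnitalStarAlgHom.norm_apply_le F (Matrix.toEuclideanCLM (𝕜 := ℂ) A)
  have h2 : F (Matrix.toEuclideanCLM (𝕜 := ℂ) A) =
      Matrix.toEuclideanCLM (𝕜 := ℂ) (siteMatrix k A) := by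
    change Matrix.toEuclideanCLM (𝕜 := ℂ) (siteMatrix k ((Matrix.toEuclideanCLM (𝕜 := ℂ)).symm
      (Matrix.toEuclideanCLM (𝕜 := ℂ) A))) = _
    rw [StarAlgEquiv.symm_apply_apply]
  rw [h2] at h
  exact h

theorem localHam_eq_sum (h : Matrix (Fin d) (Fin d) ℂ) :
    localHam d N h = ∑ k, siteMatrix k h := rfl

theorem opNorm_localHam_le (h : Matrix (Fin d) (Fin d) ℂ) :
    opNorm (localHam d N h) ≤ N * opNorm h := by
  rw [localHam_eq_sum, opNorm, map_sum]
  refine (norm_sum_le _ _).trans ((Finset.sum_le_card_nsmul _ _ (opNorm h) fun k _ =>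
    opNorm_siteMatrix_le k h).trans_eq ?_)
  simp

theorem isHermitian_localHam {h : Matrix (Fin d) (Fin d) ℂ} (hh : h.IsHermitian) :
    (localHam d N h).IsHermitian := by
  have : star (localHam d N h) = localHam d N h := by
    rw [localHam_eq_sum, star_sum]
    refine Finset.sum_congr rfl fun k _ => ?_
    have := map_star (siteHom k) h
    rw [star_eq_conjTranspose, hh.eq] at this
    exact this.symm
  exact this

/-- The locally rotated Hamiltonians `H_N · (V_1 ⊗ ⋯ ⊗ V_N)`. -/
def rotatedHam (h : Matrix (Fin d) (Fin d) ℂ) (V : Fin N → unitaryGroup (Fin d) ℂ) :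
    EuclideanSpace ℂ (Fin N → Fin d) →L[ℂ] EuclideanSpace ℂ (Fin N → Fin d) :=
  mulVecE (localHam d N h * tensorProd fun j => (V j : Matrix (Fin d) (Fin d) ℂ))

theorem norm_rotatedHam_le (h : Matrix (Fin d) (Fin d) ℂ)
    (V : Fin N → unitaryGroup (Fin d) ℂ) : ‖rotatedHam h V‖ ≤ N * opNorm h := by
  refine ContinuousLinearMap.opNorm_le_bound _
    (mul_nonneg (Nat.cast_nonneg _) (norm_nonneg _)) fun x => ?_
  rw [rotatedHam, mulVecE_mul]
  refine (ContinuousLinearMap.le_of_opNorm_le _ (opNorm_localHam_le h) _).trans_eq ?_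
  rw [norm_mulVecE_of_mem (tensorProd_mem_unitaryGroup V)]

theorem trace_vecMulVec_mul_re {n : Type*} [Fintype n] [DecidableEq n] {H : Matrix n n ℂ}
    (hH : H.IsHermitian) (v : n → ℂ) :
    (Matrix.trace (vecMulVec v (star v) * (H * H))).re =
      ‖mulVecE H (WithLp.toLp 2 v)‖ ^ 2 := by
  have h1 : Matrix.trace (vecMulVec v (star v) * (H * H)) = star (H *ᵥ v) ⬝ᵥ (H *ᵥ v) := by
    rw [vecMulVec_mul, trace_vecMulVec, star_mulVec, hH.eq, ← vecMul_vecMul,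
      dotProduct_comm, ← dotProduct_mulVec]
  rw [h1, mulVecE, Matrix.toEuclideanCLM_toLp, EuclideanSpace.norm_sq_eq, dotProduct,
    Complex.re_sum]
  refine Finset.sum_congr rfl fun i _ => ?_
  rw [Pi.star_apply, mul_comm, Complex.star_def, Complex.mul_conj, Complex.normSq_eq_norm_sq,
    Complex.ofReal_re]

theorem FLU_le_supNorm_sq {h : Matrix (Fin d) (Fin d) ℂ} (hh : h.IsHermitian)
    (ψ : (Fin N → Fin d) → ℂ) (U : specialUnitaryGroup (Fin N → Fin d) ℂ) :
    FLU d N h ψ U ≤ 4 * supNorm (rotatedHam h) (mulVecE U.1 (WithLp.toLp 2 ψ)) ^ 2 := by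
  refine ciSup_le fun V => ?_
  have h1 := norm_apply_le_supNorm (norm_rotatedHam_le (N := N) h)
    (mulVecE U.1 (WithLp.toLp 2 ψ)) V
  set W : Matrix (Fin N → Fin d) (Fin N → Fin d) ℂ :=
    tensorProd fun j => (V j : Matrix (Fin d) (Fin d) ℂ) with hW
  have h2 : W * (U.1 * vecMulVec ψ (star ψ) * star U.1) * star W =
      vecMulVec (W *ᵥ (U.1 *ᵥ ψ)) (star (W *ᵥ (U.1 *ᵥ ψ))) := by
    rw [star_mulVec, star_mulVec, mul_vecMulVec, vecMulVec_mul, mul_vecMulVec, vecMulVec_mul]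
    rfl
  have h3 : rotatedHam h V (mulVecE U.1 (WithLp.toLp 2 ψ)) =
      mulVecE (localHam d N h) (WithLp.toLp 2 (W *ᵥ (U.1 *ᵥ ψ))) := by
    rw [rotatedHam, mulVecE_mul, ← hW]
    simp only [mulVecE, Matrix.toEuclideanCLM_toLp]
  rw [h2, trace_vecMulVec_mul_re (isHermitian_localHam hh), ← h3]
  have h4 := pow_le_pow_left₀ (norm_nonneg _) h1 2
  nlinarith [sq_nonneg (Matrix.trace (vecMulVec (W *ᵥ (U.1 *ᵥ ψ)) (star (W *ᵥ (U.1 *ᵥ ψ))) *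
    localHam d N h)).re]

end Tensor

section Moments

variable {n : Type*} [Fintype n] [DecidableEq n]

/-- A unitarily invariant measure carried by the unit sphere. -/
structure IsInvariantOnSphere (ν : Measure (EuclideanSpace ℂ n)) : Prop where
  map_eq : ∀ W ∈ unitaryGroup n ℂ, ν.map (mulVecE W) = ν
  norm_eq : ∀ᵐ φ ∂ν, ‖φ‖ = 1

theorem isInvariantOnSphere_orbitMeasure (μ : Measure (specialUnitaryGroup n ℂ))
    [IsProbabilityMeasure μ] [μ.IsMulLeftInvariant] (hn : 2 ≤ Fintype.card n)
    {ψ : EuclideanSpace ℂ n} (hψ : ‖ψ‖ = 1) : IsInvariantOnSphere (orbitMeasure μ ψ) := by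
  have hae : ∀ᵐ φ ∂(orbitMeasure μ ψ), ‖φ‖ = 1 := by
    rw [orbitMeasure, ae_map_iff (measurable_mulVecE_left ψ).aemeasurable
      (measurableSet_eq_fun (by fun_prop) (by fun_prop))]
    refine Filter.Eventually.of_forall fun U => ?_
    rw [norm_mulVecE_of_mem (mem_specialUnitaryGroup_iff.1 U.2).1, hψ]
  refine ⟨fun W hW => ?_, hae⟩
  refine Measure.ext_of_lintegral _ fun f hf => ?_
  rw [lintegral_map hf (by fun_prop)]
  have hSU : ∀ V : specialUnitaryGroup n ℂ, ∀ {f : EuclideanSpace ℂ n → ENNReal},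
      Measurable f → ∫⁻ φ, f (mulVecE V.1 φ) ∂(orbitMeasure μ ψ) =
        ∫⁻ φ, f φ ∂(orbitMeasure μ ψ) := by
    intro V f hf
    rw [orbitMeasure, lintegral_map (by fun_prop) (measurable_mulVecE_left ψ),
      lintegral_map hf (measurable_mulVecE_left ψ),
      ← lintegral_mul_left_eq_self (μ := μ) (fun U => f (mulVecE U.1 ψ)) V]
    refine lintegral_congr fun U => ?_
    rw [Submonoid.coe_mul, mulVecE_mul]
  have hconj : ∀ V : specialUnitaryGroup n ℂ,
      ∫⁻ φ, f (mulVecE V.1 (mulVecE W φ)) ∂(orbitMeasure μ ψ) =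
        ∫⁻ φ, f (mulVecE W φ) ∂(orbitMeasure μ ψ) := by
    intro V
    have hmem : star W * V.1 * W ∈ specialUnitaryGroup n ℂ := by
      refine mem_specialUnitaryGroup_iff.2 ⟨mul_mem (mul_mem (Unitary.star_mem hW)
        (mem_specialUnitaryGroup_iff.1 V.2).1) hW, ?_⟩
      rw [det_mul_right_comm, (Unitary.mem_iff.1 hW).1, one_mul,
        (mem_specialUnitaryGroup_iff.1 V.2).2]
    rw [← hSU ⟨_, hmem⟩ (f := fun φ => f (mulVecE W φ)) (by fun_prop)]
    refine lintegral_congr fun φ => ?_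
    rw [← mulVecE_mul, ← mulVecE_mul, ← mul_assoc, ← mul_assoc, (Unitary.mem_iff.1 hW).2, one_mul]
  have hmeas : AEMeasurable (Function.uncurry fun (V : specialUnitaryGroup n ℂ)
      (φ : EuclideanSpace ℂ n) => f (mulVecE V.1 (mulVecE W φ)))
      (μ.prod (orbitMeasure μ ψ)) := by
    have h1 : Measurable fun p : specialUnitaryGroup n ℂ × EuclideanSpace ℂ n =>
        (p.1, mulVecE W p.2) := by fun_prop
    exact ((hf.comp measurable_mulVecE_prod).comp h1).aemeasurable
  calc ∫⁻ φ, f (mulVecE W φ) ∂(orbitMeasure μ ψ)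
      = ∫⁻ V : specialUnitaryGroup n ℂ, ∫⁻ φ, f (mulVecE V.1 (mulVecE W φ))
          ∂(orbitMeasure μ ψ) ∂μ := by
        simp_rw [hconj]; simp
    _ = ∫⁻ φ, ∫⁻ V : specialUnitaryGroup n ℂ, f (mulVecE V.1 (mulVecE W φ)) ∂μ
          ∂(orbitMeasure μ ψ) := lintegral_lintegral_swap hmeas
    _ = ∫⁻ φ, ∫⁻ φ', f φ' ∂(orbitMeasure μ ψ) ∂(orbitMeasure μ ψ) := by
        refine lintegral_congr_ae (hae.mono fun φ hφ => ?_)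
        obtain ⟨V₀, hV₀⟩ := exists_specialUnitary_mulVecE_eq hn hψ
          (v := mulVecE W φ) (by rw [norm_mulVecE_of_mem hW, hφ])
        simp only
        rw [← hV₀]
        conv_rhs => rw [orbitMeasure, lintegral_map hf (measurable_mulVecE_left ψ)]
        rw [← lintegral_mul_right_eq_of_mulLeftInvariant μ (f := fun U => f (mulVecE U.1 ψ))
          (hf.comp (measurable_mulVecE_left ψ)) V₀]
        refine lintegral_congr fun U => ?_
        rw [Submonoid.coe_mul, mulVecE_mul]
    _ = _ := by simp

namespace IsInvariantOnSphere

variable {ν : Measure (EuclideanSpace ℂ n)}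

theorem integrable [IsProbabilityMeasure ν] (hν : IsInvariantOnSphere ν) {F : Type*}
    [NormedAddCommGroup F] [SecondCountableTopology F] {f : EuclideanSpace ℂ n → F} (hf : Continuous f) :
    Integrable f ν := by
  obtain ⟨C, hC⟩ := (isCompact_sphere (0 : EuclideanSpace ℂ n) 1).exists_bound_of_continuousOn
    hf.continuousOn
  borelize F
  exact Integrable.of_bound hf.aestronglyMeasurable C
    (hν.norm_eq.mono fun φ hφ => hC φ (by simpa using hφ))

theorem integral_comp (hν : IsInvariantOnSphere ν) {F : Type*} [NormedAddCommGroup F]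
    [NormedSpace ℝ F] [SecondCountableTopology F]
    {f : EuclideanSpace ℂ n → F} (hf : Continuous f) {W : Matrix n n ℂ}
    (hW : W ∈ unitaryGroup n ℂ) : ∫ φ, f (mulVecE W φ) ∂ν = ∫ φ, f φ ∂ν := by
  borelize F
  conv_rhs => rw [← hν.map_eq W hW]
  rw [integral_map (by fun_prop) hf.aestronglyMeasurable]

theorem diagonal_mem_unitaryGroup {z : n → ℂ} (hz : ∀ i, z i * star (z i) = 1) :
    diagonal z ∈ unitaryGroup n ℂ := by
  rw [mem_unitaryGroup_iff, star_eq_conjTranspose, diagonal_conjTranspose,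
    diagonal_mul_diagonal, ← diagonal_one]
  congr 1
  funext i
  exact hz i

theorem mulVecE_diagonal (z : n → ℂ) (x : EuclideanSpace ℂ n) (i : n) :
    mulVecE (diagonal z) x i = z i * x i := by
  rw [mulVecE_apply]
  simp [diagonal_apply]

/-- Invariance under multiplying one coordinate by a phase. -/
theorem integral_phase (hν : IsInvariantOnSphere ν) {F : Type*} [NormedAddCommGroup F]
    [NormedSpace ℝ F] [SecondCountableTopology F]
    {f : EuclideanSpace ℂ n → F} (hf : Continuous f) (y : n) {ζ : ℂ} (hζ : ζ * star ζ = 1) :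
    ∫ φ, f (mulVecE (diagonal (Function.update 1 y ζ)) φ) ∂ν = ∫ φ, f φ ∂ν := by
  refine hν.integral_comp hf (diagonal_mem_unitaryGroup fun i => ?_)
  by_cases h : i = y
  · subst h; simpa using hζ
  · simp [h]

/-- The reflection mixing two coordinates with coefficients `3/5` and `4/5`. -/
theorem exists_reflection {x y : n} (hxy : x ≠ y) :
    ∃ W ∈ unitaryGroup n ℂ, ∀ φ : EuclideanSpace ℂ n,
      mulVecE W φ x = (3 / 5 : ℝ) * φ x + (4 / 5 : ℝ) * φ y ∧
      mulVecE W φ y = (4 / 5 : ℝ) * φ x - (3 / 5 : ℝ) * φ y := by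
  set v : n → ℂ := Pi.single x 1 - (2 : ℂ) • Pi.single y 1 with hv
  have hvs : star v = v := by
    rw [hv]; simp [Pi.star_single]
  have hvv : v ⬝ᵥ v = 5 := by
    rw [hv]
    simp [hxy, hxy.symm]
    norm_num
  have hVV : vecMulVec v v * vecMulVec v v = (5 : ℂ) • vecMulVec v v := by
    rw [vecMulVec_mul_vecMulVec, hvv, vecMulVec_smul]
  refine ⟨1 - (2 / 5 : ℂ) • vecMulVec v v, ?_, fun φ => ?_⟩
  · have hs : star (1 - (2 / 5 : ℂ) • vecMulVec v v) = 1 - (2 / 5 : ℂ) • vecMulVec v v := by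
      rw [star_sub, star_one, star_smul, star_eq_conjTranspose, conjTranspose_vecMulVec, hvs]
      simp
    rw [mem_unitaryGroup_iff, hs, sub_mul, one_mul, mul_sub, mul_one, smul_mul_smul_comm,
      hVV, smul_smul]
    module
  · have h1 : ∀ i, mulVecE (1 - (2 / 5 : ℂ) • vecMulVec v v) φ i =
        φ i - 2 / 5 * v i * (φ x - 2 * φ y) := by
      intro i
      have h2 : v ⬝ᵥ φ.ofLp = φ x - 2 * φ y := by
        rw [hv]; simp [sub_dotProduct]
      rw [mulVecE, Matrix.ofLp_toEuclideanCLM, sub_mulVec, one_mulVec, smul_mulVec,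
        vecMulVec_mulVec, h2]
      simp
      ring
    rw [h1, h1]
    constructor
    · simp [hv, hxy]
      ring
    · simp [hv, hxy.symm]
      ring

theorem integral_normSq_mul_re (hν : IsInvariantOnSphere ν) {x y : n} (hxy : x ≠ y) (z : n) :
    ∫ φ, ‖φ z‖ ^ 2 * (φ x * star (φ y)).re ∂ν = 0 := by
  have h := hν.integral_phase (f := fun φ => ‖φ z‖ ^ 2 * (φ x * star (φ y)).re)
    (by fun_prop) y (ζ := -1) (by simp)
  have h2 : ∀ φ : EuclideanSpace ℂ n,
      ‖mulVecE (diagonal (Function.update 1 y (-1))) φ z‖ ^ 2 *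
        (mulVecE (diagonal (Function.update 1 y (-1))) φ x *
          star (mulVecE (diagonal (Function.update 1 y (-1))) φ y)).re =
        -(‖φ z‖ ^ 2 * (φ x * star (φ y)).re) := by
    intro φ
    have h3 : ‖mulVecE (diagonal (Function.update 1 y (-1))) φ z‖ = ‖φ z‖ := by
      rw [mulVecE_diagonal]
      by_cases h : z = y
      · subst h; simp
      · simp [h]
    rw [h3, mulVecE_diagonal, mulVecE_diagonal]
    simp [hxy]
    ring
  simp only [h2, integral_neg] at h
  linarith

theorem integral_re_sq [IsProbabilityMeasure ν] (hν : IsInvariantOnSphere ν)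
    {x y : n} (hxy : x ≠ y) :
    ∫ φ, (φ x * star (φ y)).re ^ 2 ∂ν = (∫ φ, ‖φ x‖ ^ 2 * ‖φ y‖ ^ 2 ∂ν) / 2 := by
  have h := hν.integral_phase (f := fun φ => (φ x * star (φ y)).re ^ 2)
    (by fun_prop) y (ζ := Complex.I) (by simp)
  have h2 : ∀ φ : EuclideanSpace ℂ n,
      (mulVecE (diagonal (Function.update 1 y Complex.I)) φ x *
          star (mulVecE (diagonal (Function.update 1 y Complex.I)) φ y)).re ^ 2 =
        ‖φ x‖ ^ 2 * ‖φ y‖ ^ 2 - (φ x * star (φ y)).re ^ 2 := by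
    intro φ
    rw [mulVecE_diagonal, mulVecE_diagonal, ← Complex.normSq_eq_norm_sq,
      ← Complex.normSq_eq_norm_sq]
    simp [hxy, Complex.normSq_apply]
    ring
  simp only [h2] at h
  rw [integral_sub (hν.integrable (by fun_prop)) (hν.integrable (by fun_prop))] at h
  linarith

theorem integral_norm_pow_four [IsProbabilityMeasure ν] (hν : IsInvariantOnSphere ν)
    {x y : n} (hxy : x ≠ y) :
    ∫ φ, ‖φ x‖ ^ 2 * ‖φ x‖ ^ 2 ∂ν = 2 * ∫ φ, ‖φ x‖ ^ 2 * ‖φ y‖ ^ 2 ∂ν := by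
  have key : ∀ α β : ℝ, ∫ φ : EuclideanSpace ℂ n, ‖(α : ℂ) * φ x + (β : ℂ) * φ y‖ ^ 2 *
      ‖(α : ℂ) * φ x + (β : ℂ) * φ y‖ ^ 2 ∂ν =
      α ^ 4 * ∫ φ, ‖φ x‖ ^ 2 * ‖φ x‖ ^ 2 ∂ν + β ^ 4 * ∫ φ, ‖φ y‖ ^ 2 * ‖φ y‖ ^ 2 ∂ν +
        4 * α ^ 2 * β ^ 2 * ∫ φ, ‖φ x‖ ^ 2 * ‖φ y‖ ^ 2 ∂ν := by
    intro α β
    have h1 : (fun φ : EuclideanSpace ℂ n => ‖(α : ℂ) * φ x + (β : ℂ) * φ y‖ ^ 2 *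
        ‖(α : ℂ) * φ x + (β : ℂ) * φ y‖ ^ 2) =
        (fun φ => α ^ 4 * (‖φ x‖ ^ 2 * ‖φ x‖ ^ 2)) +
        (fun φ => β ^ 4 * (‖φ y‖ ^ 2 * ‖φ y‖ ^ 2)) +
        (fun φ => 2 * α ^ 2 * β ^ 2 * (‖φ x‖ ^ 2 * ‖φ y‖ ^ 2)) +
        (fun φ => 4 * α ^ 2 * β ^ 2 * (φ x * star (φ y)).re ^ 2) +
        (fun φ => 4 * α ^ 3 * β * (‖φ x‖ ^ 2 * (φ x * star (φ y)).re)) +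
        (fun φ => 4 * α * β ^ 3 * (‖φ y‖ ^ 2 * (φ x * star (φ y)).re)) := by
      funext φ
      simp only [Pi.add_apply, ← Complex.normSq_eq_norm_sq, Complex.normSq_apply]
      simp
      ring
    have hc1 : Continuous fun φ : EuclideanSpace ℂ n => ‖φ x‖ ^ 2 * ‖φ x‖ ^ 2 := by fun_prop
    have hc2 : Continuous fun φ : EuclideanSpace ℂ n => ‖φ y‖ ^ 2 * ‖φ y‖ ^ 2 := by fun_prop
    have hc3 : Continuous fun φ : EuclideanSpace ℂ n => ‖φ x‖ ^ 2 * ‖φ y‖ ^ 2 := by fun_prop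
    have hc4 : Continuous fun φ : EuclideanSpace ℂ n => (φ x * star (φ y)).re ^ 2 := by fun_prop
    have hc5 : Continuous fun φ : EuclideanSpace ℂ n =>
      ‖φ x‖ ^ 2 * (φ x * star (φ y)).re := by fun_prop
    have hc6 : Continuous fun φ : EuclideanSpace ℂ n =>
      ‖φ y‖ ^ 2 * (φ x * star (φ y)).re := by fun_prop
    have i1 := (hν.integrable hc1).const_mul (α ^ 4)
    have i2 := (hν.integrable hc2).const_mul (β ^ 4)
    have i3 := (hν.integrable hc3).const_mul (2 * α ^ 2 * β ^ 2)
    have i4 := (hν.integrable hc4).const_mul (4 * α ^ 2 * β ^ 2)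
    have i5 := (hν.integrable hc5).const_mul (4 * α ^ 3 * β)
    have i6 := (hν.integrable hc6).const_mul (4 * α * β ^ 3)
    rw [h1, integral_add' ((((i1.add i2).add i3).add i4).add i5) i6,
      integral_add' (((i1.add i2).add i3).add i4) i5, integral_add' ((i1.add i2).add i3) i4,
      integral_add' (i1.add i2) i3, integral_add' i1 i2]
    simp only [integral_const_mul]
    rw [hν.integral_re_sq hxy, hν.integral_normSq_mul_re hxy, hν.integral_normSq_mul_re hxy]
    ring
  obtain ⟨W, hW, hWφ⟩ := exists_reflection hxy
  have e1 := hν.integral_comp (f := fun φ => ‖φ x‖ ^ 2 * ‖φ x‖ ^ 2) (by fun_prop) hW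
  have e2 := hν.integral_comp (f := fun φ => ‖φ y‖ ^ 2 * ‖φ y‖ ^ 2) (by fun_prop) hW
  simp only [fun φ => (hWφ φ).1, fun φ => (hWφ φ).2] at e1 e2
  rw [key] at e1
  have e3 := key (4 / 5) (-(3 / 5))
  simp only [Complex.ofReal_neg, neg_mul, ← sub_eq_add_neg] at e3
  rw [e3] at e2
  linarith

/-- The second moments of the squared moduli of the coordinates. -/
theorem integral_normSq_mul_normSq [IsProbabilityMeasure ν] (hν : IsInvariantOnSphere ν)
    (hn : 2 ≤ Fintype.card n)
    (x y : n) : ∫ φ, ‖φ x‖ ^ 2 * ‖φ y‖ ^ 2 ∂ν =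
      (1 + if x = y then 1 else 0) / (Fintype.card n * (Fintype.card n + 1)) := by
  set m : n → n → ℝ := fun x y => ∫ φ, ‖φ x‖ ^ 2 * ‖φ y‖ ^ 2 ∂ν with hm
  have hsymm : ∀ x y, m x y = m y x := fun x y => by simp only [hm, mul_comm]
  have hne : ∀ x y, x ≠ y → m x x = 2 * m x y := fun x y h => hν.integral_norm_pow_four h
  have hdiag : ∀ x y, m x x = m y y := by
    intro x y
    rcases eq_or_ne x y with rfl | h
    · rfl
    · rw [hne x y h, hne y x h.symm, hsymm]
  have hsum : ∑ x, ∑ y, m x y = 1 := by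
    have h1 : ∀ᵐ φ ∂ν, ∑ x, ∑ y, ‖φ x‖ ^ 2 * ‖φ y‖ ^ 2 = (1 : ℝ) := by
      refine hν.norm_eq.mono fun φ hφ => ?_
      have : ∑ x, ‖φ x‖ ^ 2 = 1 := by rw [← EuclideanSpace.norm_sq_eq, hφ, one_pow]
      rw [← Finset.sum_mul_sum, this, one_mul]
    have h2 := integral_congr_ae h1
    rw [integral_finsetSum _ fun x _ => hν.integrable (by fun_prop)] at h2
    simp_rw [fun x => integral_finsetSum (μ := ν) Finset.univ
      (f := fun y (φ : EuclideanSpace ℂ n) => ‖φ x‖ ^ 2 * ‖φ y‖ ^ 2)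
      fun y _ => hν.integrable (by fun_prop)] at h2
    simpa using h2
  obtain ⟨q, hform⟩ : ∃ q, ∀ a b, m a b = q * (1 + if a = b then 1 else 0) := by
    refine ⟨m x x / 2, fun a b => ?_⟩
    split_ifs with h
    · subst h; rw [hdiag a x]; ring
    · have := hne a b h
      rw [hdiag x a, this]; ring
  have hD : (0 : ℝ) < Fintype.card n := by exact_mod_cast (by omega : 0 < Fintype.card n)
  simp only [hform, ← Finset.mul_sum, Finset.sum_add_distrib, Finset.sum_const, Finset.card_univ,
    Finset.sum_ite_eq, Finset.mem_univ, if_true, nsmul_eq_mul, mul_one] at hsum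
  change m x y = _
  rw [hform, eq_div_iff (by positivity)]
  linear_combination (1 + if x = y then (1 : ℝ) else 0) * hsum

end IsInvariantOnSphere

end Moments

section Reduced

variable {n A B : Type*} (e : n ≃ A × B)

theorem IsInvariantOnSphere.integral_reduced_term [Fintype n] [DecidableEq n] [DecidableEq A]
    [DecidableEq B] {ν : Measure (EuclideanSpace ℂ n)} [IsProbabilityMeasure ν]
    (hν : IsInvariantOnSphere ν) (hn : 2 ≤ Fintype.card n) (a a' : A) (b b' : B) :
    ∫ φ, φ (e.symm (a, b)) * star (φ (e.symm (a', b))) *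
        star (φ (e.symm (a, b')) * star (φ (e.symm (a', b')))) ∂ν =
      ((((if a = a' then 1 else 0) + if b = b' then 1 else 0) /
        (Fintype.card n * (Fintype.card n + 1)) : ℝ) : ℂ) := by
  have hcc : ∀ x y : ℂ, x * star x * star (y * star y) = ((‖x‖ ^ 2 * ‖y‖ ^ 2 : ℝ) : ℂ) := by
    intro x y
    simp only [Complex.star_def, map_mul, Complex.conj_conj]
    rw [mul_comm (starRingEnd ℂ y), Complex.mul_conj, Complex.mul_conj,
      Complex.normSq_eq_norm_sq, Complex.normSq_eq_norm_sq]
    push_cast; rfl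
  by_cases ha : a = a'
  · subst ha
    simp_rw [hcc]
    rw [integral_complex_ofReal, hν.integral_normSq_mul_normSq hn]
    simp
  by_cases hb : b = b'
  · subst hb
    have : ∀ φ : EuclideanSpace ℂ n, φ (e.symm (a, b)) * star (φ (e.symm (a', b))) *
        star (φ (e.symm (a, b)) * star (φ (e.symm (a', b)))) =
        ((‖φ (e.symm (a, b))‖ ^ 2 * ‖φ (e.symm (a', b))‖ ^ 2 : ℝ) : ℂ) := by
      intro φ
      rw [← hcc]
      simp only [star_mul', star_star]
      ring
    simp_rw [this]
    rw [integral_complex_ofReal, hν.integral_normSq_mul_normSq hn]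
    simp [ha]
  · have h := hν.integral_phase (f := fun φ => φ (e.symm (a, b)) * star (φ (e.symm (a', b))) *
        star (φ (e.symm (a, b')) * star (φ (e.symm (a', b'))))) (by fun_prop)
        (e.symm (a, b)) (ζ := -1) (by simp)
    have hne1 : e.symm (a', b) ≠ e.symm (a, b) := by simp [Ne.symm ha]
    have hne2 : e.symm (a, b') ≠ e.symm (a, b) := by simp [Ne.symm hb]
    have hne3 : e.symm (a', b') ≠ e.symm (a, b) := by simp [Ne.symm ha]
    simp only [mulVecE_diagonal, Function.update_self, Function.update_of_ne hne1,
      Function.update_of_ne hne2, Function.update_of_ne hne3, Pi.one_apply, one_mul, neg_mul,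
      integral_neg] at h
    simp only [ha, hb, if_false, add_zero, zero_div, Complex.ofReal_zero]
    exact self_eq_neg.1 h.symm

variable [Fintype B]

/-- The reduced density matrix of a pure state with respect to a bipartition. -/
def reduced (φ : EuclideanSpace ℂ n) (a a' : A) : ℂ :=
  ∑ b, φ (e.symm (a, b)) * star (φ (e.symm (a', b)))

theorem continuous_reduced (a a' : A) :
    Continuous fun φ : EuclideanSpace ℂ n => reduced e φ a a' := by
  unfold reduced; fun_prop

theorem IsInvariantOnSphere.integral_norm_reduced_sq [Fintype n] [DecidableEq n] [DecidableEq A]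
    [DecidableEq B] {ν : Measure (EuclideanSpace ℂ n)} [IsProbabilityMeasure ν]
    (hν : IsInvariantOnSphere ν) (hn : 2 ≤ Fintype.card n) (a a' : A) :
    ∫ φ, ‖reduced e φ a a'‖ ^ 2 ∂ν = ∑ b : B, ∑ b' : B,
      ((if a = a' then 1 else 0) + if b = b' then 1 else 0) /
        (Fintype.card n * (Fintype.card n + 1) : ℝ) := by
  have h1 : ∀ φ : EuclideanSpace ℂ n, ((‖reduced e φ a a'‖ ^ 2 : ℝ) : ℂ) = ∑ b, ∑ b',
      φ (e.symm (a, b)) * star (φ (e.symm (a', b))) *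
        star (φ (e.symm (a, b')) * star (φ (e.symm (a', b')))) := by
    intro φ
    rw [← Complex.normSq_eq_norm_sq, ← Complex.mul_conj, ← Complex.star_def, reduced, star_sum,
      Finset.sum_mul_sum]
  apply Complex.ofReal_injective
  rw [← integral_complex_ofReal]
  simp_rw [h1]
  rw [integral_finsetSum _ fun b _ => hν.integrable (by fun_prop)]
  push_cast
  refine Finset.sum_congr rfl fun b _ => ?_
  rw [integral_finsetSum _ fun b' _ => hν.integrable (by fun_prop)]
  refine Finset.sum_congr rfl fun b' _ => ?_
  rw [hν.integral_reduced_term e hn]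
  push_cast
  rfl

variable [Fintype A] [DecidableEq A]

/-- The squared Hilbert–Schmidt distance of the reduced state to the maximally mixed state. -/
def deviation (φ : EuclideanSpace ℂ n) : ℝ :=
  ∑ a, ∑ a', ‖reduced e φ a a' - if a = a' then ((1 / Fintype.card A : ℝ) : ℂ) else 0‖ ^ 2

theorem deviation_nonneg (φ : EuclideanSpace ℂ n) : 0 ≤ deviation e φ :=
  Finset.sum_nonneg fun _ _ => Finset.sum_nonneg fun _ _ => sq_nonneg _

theorem continuous_deviation : Continuous fun φ : EuclideanSpace ℂ n => deviation e φ :=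
  continuous_finsetSum _ fun a _ => continuous_finsetSum _ fun a' _ =>
    (((continuous_reduced e a a').sub continuous_const).norm).pow 2

theorem deviation_eq [Fintype n] [Nonempty A] {φ : EuclideanSpace ℂ n} (hφ : ‖φ‖ = 1) :
    deviation e φ = ∑ a, ∑ a', ‖reduced e φ a a'‖ ^ 2 - 1 / Fintype.card A := by
  have hA : (Fintype.card A : ℝ) ≠ 0 := by exact_mod_cast Fintype.card_ne_zero
  have htr : ∑ a, (reduced e φ a a).re = 1 := by
    calc ∑ a, (reduced e φ a a).re = ∑ a, ∑ b, ‖φ (e.symm (a, b))‖ ^ 2 := by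
          refine Finset.sum_congr rfl fun a _ => ?_
          rw [reduced, Complex.re_sum]
          refine Finset.sum_congr rfl fun b _ => ?_
          rw [Complex.star_def, Complex.mul_conj, Complex.ofReal_re, Complex.normSq_eq_norm_sq]
      _ = ∑ x, ‖φ x‖ ^ 2 := by
          rw [← Fintype.sum_prod_type' (fun a b => ‖φ (e.symm (a, b))‖ ^ 2)]
          exact e.symm.sum_comp (fun x => ‖φ x‖ ^ 2)
      _ = 1 := by rw [← EuclideanSpace.norm_sq_eq, hφ, one_pow]
  have hterm : ∀ a a', ‖reduced e φ a a' - if a = a' then ((1 / Fintype.card A : ℝ) : ℂ) else 0‖ ^ 2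
      = ‖reduced e φ a a'‖ ^ 2 + if a = a' then
        (1 / Fintype.card A : ℝ) ^ 2 - 2 * (1 / Fintype.card A) * (reduced e φ a a).re else 0 := by
    intro a a'
    split_ifs with h
    · subst h
      rw [← Complex.normSq_eq_norm_sq, ← Complex.normSq_eq_norm_sq, Complex.normSq_apply,
        Complex.normSq_apply, Complex.sub_re, Complex.sub_im, Complex.ofReal_re, Complex.ofReal_im]
      ring
    · simp
  simp only [deviation, hterm, Finset.sum_add_distrib, Finset.sum_ite_eq, Finset.mem_univ, if_true,
    Finset.sum_sub_distrib, ← Finset.mul_sum, htr, Finset.sum_const, Finset.card_univ, nsmul_eq_mul]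
  field_simp
  ring

/-- Pairing of the reduced state with a traceless matrix. -/
theorem re_sum_mul_reduced_le (κ : A → A → ℂ) (hκ : ∑ a, κ a a = 0) (φ : EuclideanSpace ℂ n) :
    (∑ a, ∑ a', κ a a' * reduced e φ a' a).re ≤
      Real.sqrt (∑ a, ∑ a', ‖κ a a'‖ ^ 2) * Real.sqrt (deviation e φ) := by
  set δ : A → A → ℂ := fun a a' => if a = a' then ((1 / Fintype.card A : ℝ) : ℂ) else 0 with hδ
  have h1 : ∑ a, ∑ a', κ a a' * reduced e φ a' a =
      ∑ a, ∑ a', κ a a' * (reduced e φ a' a - δ a' a) := by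
    simp only [mul_sub, Finset.sum_sub_distrib]
    have : ∑ a, ∑ a', κ a a' * δ a' a = 0 := by
      simp [hδ, ← Finset.sum_mul, hκ]
    rw [this, sub_zero]
  have h2 : deviation e φ = ∑ a, ∑ a', ‖reduced e φ a' a - δ a' a‖ ^ 2 := by
    rw [deviation, Finset.sum_comm]
  rw [h1, h2]
  refine (Complex.re_le_norm _).trans ?_
  calc ‖∑ a, ∑ a', κ a a' * (reduced e φ a' a - δ a' a)‖
      ≤ ∑ a, ∑ a', ‖κ a a'‖ * ‖reduced e φ a' a - δ a' a‖ := by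
        refine (norm_sum_le _ _).trans (Finset.sum_le_sum fun a _ => ?_)
        refine (norm_sum_le _ _).trans (Finset.sum_le_sum fun a' _ => (norm_mul _ _).le)
    _ ≤ _ := by
        simp only [← Fintype.sum_prod_type']
        exact Real.sum_mul_le_sqrt_mul_sqrt Finset.univ (fun p : A × A => ‖κ p.1 p.2‖)
          (fun p : A × A => ‖reduced e φ p.2 p.1 - δ p.2 p.1‖)

namespace IsInvariantOnSphere

variable [Fintype n] [DecidableEq n] {ν : Measure (EuclideanSpace ℂ n)}
  [IsProbabilityMeasure ν]

theorem integral_deviation_le [Nonempty A] (hν : IsInvariantOnSphere ν)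
    (hn : 2 ≤ Fintype.card n) :
    ∫ φ, deviation e φ ∂ν ≤ Fintype.card A / Fintype.card n := by
  classical
  have hcont : ∀ a a', Continuous fun φ : EuclideanSpace ℂ n => ‖reduced e φ a a'‖ ^ 2 :=
    fun a a' => ((continuous_reduced e a a').norm).pow 2
  have hD : (Fintype.card n : ℝ) = Fintype.card A * Fintype.card B := by
    rw [Fintype.card_congr e, Fintype.card_prod, Nat.cast_mul]
  have hA : (0 : ℝ) < Fintype.card A := by exact_mod_cast Fintype.card_pos
  have hn0 : (0 : ℝ) < Fintype.card n := by exact_mod_cast (by omega : 0 < Fintype.card n)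
  have hB : (0 : ℝ) < Fintype.card B := by
    rw [hD] at hn0; exact pos_of_mul_pos_right hn0 hA.le
  rw [integral_congr_ae (hν.norm_eq.mono fun φ hφ => deviation_eq e hφ),
    integral_sub (hν.integrable (continuous_finsetSum _ fun a _ => continuous_finsetSum _
      fun a' _ => hcont a a')) (integrable_const _),
    integral_finsetSum _ fun a _ => hν.integrable (continuous_finsetSum _ fun a' _ => hcont a a')]
  simp_rw [fun a => integral_finsetSum (μ := ν) Finset.univ
    (f := fun a' (φ : EuclideanSpace ℂ n) => ‖reduced e φ a a'‖ ^ 2)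
    fun a' _ => hν.integrable (hcont a a'), hν.integral_norm_reduced_sq e hn, ← Finset.sum_div]
  simp only [Finset.sum_add_distrib, Finset.sum_const, Finset.card_univ, Finset.sum_ite_eq,
    Finset.mem_univ, if_true, nsmul_eq_mul, mul_one, integral_const, probReal_univ, one_smul,
    ← Finset.mul_sum]
  rw [hD, div_sub_div _ _ (by positivity) hA.ne', div_le_div_iff₀ (by positivity) (by positivity)]
  set p : ℝ := (Fintype.card A : ℝ)
  set q : ℝ := (Fintype.card B : ℝ)
  have h1 : 0 ≤ p ^ 2 * q * (p * q) * (p * p + p * q) := by positivity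
  nlinarith [h1]

theorem integral_sqrt_deviation_le [Nonempty A] (hν : IsInvariantOnSphere ν)
    (hn : 2 ≤ Fintype.card n) :
    ∫ φ, Real.sqrt (deviation e φ) ∂ν ≤ Real.sqrt (Fintype.card A / Fintype.card n) := by
  have hA : (0 : ℝ) < Fintype.card A := by exact_mod_cast Fintype.card_pos
  have hn0 : (0 : ℝ) < Fintype.card n := by exact_mod_cast (by omega : 0 < Fintype.card n)
  set c := Real.sqrt (Fintype.card A / Fintype.card n) with hc
  have hc0 : 0 < c := Real.sqrt_pos.2 (by positivity)
  have hc2 : c ^ 2 = Fintype.card A / Fintype.card n := Real.sq_sqrt (by positivity)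
  have hpt : ∀ φ : EuclideanSpace ℂ n, Real.sqrt (deviation e φ) ≤
      (2 * c)⁻¹ * deviation e φ + c / 2 := by
    intro φ
    have h1 := Real.sq_sqrt (deviation_nonneg e φ)
    rw [inv_mul_eq_div, div_add_div _ _ (by positivity) two_ne_zero, le_div_iff₀ (by positivity)]
    nlinarith [sq_nonneg (Real.sqrt (deviation e φ) - c)]
  have hi := hν.integrable (continuous_deviation e)
  calc ∫ φ, Real.sqrt (deviation e φ) ∂ν
      ≤ ∫ φ, ((2 * c)⁻¹ * deviation e φ + c / 2) ∂ν :=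
        integral_mono (hν.integrable (continuous_deviation e).sqrt)
          ((hi.const_mul _).add (integrable_const _)) hpt
    _ = (2 * c)⁻¹ * ∫ φ, deviation e φ ∂ν + c / 2 := by
        rw [integral_add (hi.const_mul _) (integrable_const _), integral_const_mul]; simp
    _ ≤ (2 * c)⁻¹ * c ^ 2 + c / 2 := by
        rw [hc2]; gcongr; exact hν.integral_deviation_le e hn
    _ = c := by field_simp; ring

end IsInvariantOnSphere

end Reduced

section Pairs

variable {d N : ℕ}

theorem sum_norm_sq_le {n : Type*} [Fintype n] [DecidableEq n] (M : Matrix n n ℂ) :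
    ∑ a, ∑ b, ‖M a b‖ ^ 2 ≤ Fintype.card n * opNorm M ^ 2 := by
  rw [Finset.sum_comm]
  refine (Finset.sum_le_card_nsmul _ _ (opNorm M ^ 2) fun b _ => ?_).trans_eq (by simp)
  have h1 := (mulVecE M).le_opNorm (EuclideanSpace.single b 1)
  rw [PiLp.norm_single, norm_one, mul_one] at h1
  calc ∑ a, ‖M a b‖ ^ 2 = ‖mulVecE M (EuclideanSpace.single b 1)‖ ^ 2 := by
        rw [EuclideanSpace.norm_sq_eq]
        refine Finset.sum_congr rfl fun a _ => ?_
        rw [mulVecE_apply]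
        simp
    _ ≤ _ := pow_le_pow_left₀ (norm_nonneg _) h1 2

theorem opNorm_conj_le {n : Type*} [Fintype n] [DecidableEq n] {V : Matrix n n ℂ}
    (hV : V ∈ unitaryGroup n ℂ) (M : Matrix n n ℂ) : opNorm (star V * M * V) ≤ opNorm M := by
  refine ContinuousLinearMap.opNorm_le_bound _ (norm_nonneg _) fun x => ?_
  change ‖mulVecE (star V * M * V) x‖ ≤ _
  rw [mul_assoc, mulVecE_mul, norm_mulVecE_of_mem (Unitary.star_mem hV), mulVecE_mul]
  refine (ContinuousLinearMap.le_opNorm (mulVecE M) _).trans_eq ?_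
  rw [norm_mulVecE_of_mem hV]
  rfl

theorem inner_mulVecE_mulVecE {n : Type*} [Fintype n] [DecidableEq n] (A B : Matrix n n ℂ)
    (φ : EuclideanSpace ℂ n) :
    inner ℂ (mulVecE A φ) (mulVecE B φ) = inner ℂ φ (mulVecE (star A * B) φ) := by
  rw [mulVecE_mul]
  have : mulVecE (star A) = ContinuousLinearMap.adjoint (mulVecE A) :=
    map_star (Matrix.toEuclideanCLM (n := n) (𝕜 := ℂ)) A
  rw [this, ContinuousLinearMap.adjoint_inner_right]

/-- The bipartition separating sites `i` and `j` from the others. -/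
def splitPair (d : ℕ) (i j : Fin N) : (Fin N → Fin d) ≃
    ({k // k = i ∨ k = j} → Fin d) × ({k // ¬(k = i ∨ k = j)} → Fin d) :=
  Equiv.piEquivPiSubtypeProd (fun k => k = i ∨ k = j) fun _ => Fin d

theorem card_pair_subtype {i j : Fin N} (hij : i ≠ j) :
    Fintype.card {k // k = i ∨ k = j} = 2 := by
  rw [Fintype.card_subtype, ← Finset.card_pair hij]
  congr 1
  ext k
  simp

theorem re_inner_tensorProd_le {i j : Fin N} (hij : i ≠ j)
    {M : Fin N → Matrix (Fin d) (Fin d) ℂ} (hM : ∀ k, ¬(k = i ∨ k = j) → M k = 1)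
    (htr : Matrix.trace (M i) = 0) {c : ℝ}
    (hMi : ∀ k, k = i ∨ k = j → opNorm (M k) ≤ c) (φ : EuclideanSpace ℂ (Fin N → Fin d)) :
    (inner ℂ φ (mulVecE (tensorProd M) φ)).re ≤
      d * c ^ 2 * Real.sqrt (deviation (splitPair d i j) φ) := by
  set e := splitPair (N := N) d i j with he
  set κ : ({k // k = i ∨ k = j} → Fin d) → ({k // k = i ∨ k = j} → Fin d) → ℂ :=
    fun a a' => ∏ k : {k // k = i ∨ k = j}, M k (a k) (a' k) with hκ
  have htens : ∀ a b a' b', tensorProd M (e.symm (a, b)) (e.symm (a', b')) =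
      κ a a' * if b = b' then 1 else 0 := by
    intro a b a' b'
    rw [tensorProd, Matrix.of_apply,
      ← Fintype.prod_subtype_mul_prod_subtype (fun k => k = i ∨ k = j)]
    congr 1
    · refine Finset.prod_congr rfl fun k _ => ?_
      simp [he, splitPair, Equiv.piEquivPiSubtypeProd, k.2]
    · calc _ = ∏ k : {k // ¬(k = i ∨ k = j)}, if b k = b' k then (1 : ℂ) else 0 := by
            refine Finset.prod_congr rfl fun k _ => ?_
            rw [hM k k.2]
            simp [he, splitPair, Equiv.piEquivPiSubtypeProd, k.2, Matrix.one_apply]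
        _ = _ := by
            rw [Finset.prod_ite_zero]
            simp [funext_iff]
  have hinner : inner ℂ φ (mulVecE (tensorProd M) φ) =
      ∑ a, ∑ a', κ a a' * reduced e φ a' a := by
    calc inner ℂ φ (mulVecE (tensorProd M) φ)
        = ∑ x, ∑ y, tensorProd M x y * φ y * star (φ x) := by
          rw [PiLp.inner_apply]
          refine Finset.sum_congr rfl fun x _ => ?_
          rw [RCLike.inner_apply, mulVecE_apply, Finset.sum_mul]
          rfl
      _ = ∑ a, ∑ b, ∑ a', ∑ b', tensorProd M (e.symm (a, b)) (e.symm (a', b')) *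
            φ (e.symm (a', b')) * star (φ (e.symm (a, b))) := by
          rw [← e.symm.sum_comp, Fintype.sum_prod_type]
          refine Finset.sum_congr rfl fun a _ => Finset.sum_congr rfl fun b _ => ?_
          rw [← e.symm.sum_comp, Fintype.sum_prod_type]
      _ = _ := by
          refine Finset.sum_congr rfl fun a _ => ?_
          rw [Finset.sum_comm]
          refine Finset.sum_congr rfl fun a' _ => ?_
          rw [reduced, Finset.mul_sum]
          refine Finset.sum_congr rfl fun b _ => ?_
          simp [htens, mul_assoc]
  have htrκ : ∑ a, κ a a = 0 := by
    have h1 := Finset.prod_univ_sum (fun _ : {k // k = i ∨ k = j} => (Finset.univ : Finset (Fin d)))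
      (fun k c => M k c c)
    rw [Fintype.piFinset_univ] at h1
    rw [hκ, ← h1]
    exact Finset.prod_eq_zero (i := ⟨i, Or.inl rfl⟩) (Finset.mem_univ _) htr
  have hfrob : ∑ a, ∑ a', ‖κ a a'‖ ^ 2 ≤ (d * c ^ 2) ^ 2 := by
    have h1 : ∑ a, ∑ a', ‖κ a a'‖ ^ 2 =
        ∏ k : {k // k = i ∨ k = j}, ∑ a, ∑ a', ‖M k a a'‖ ^ 2 := by
      simp only [Finset.prod_univ_sum, Fintype.piFinset_univ, hκ, norm_prod, Finset.prod_pow]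
    rw [h1]
    calc _ ≤ ∏ k : {k // k = i ∨ k = j}, d * c ^ 2 := by
          refine Finset.prod_le_prod (fun k _ => Finset.sum_nonneg fun a _ =>
            Finset.sum_nonneg fun a' _ => sq_nonneg _) fun k _ => ?_
          refine (sum_norm_sq_le _).trans ?_
          rw [Fintype.card_fin]
          exact mul_le_mul_of_nonneg_left
            (pow_le_pow_left₀ (norm_nonneg _) (hMi k k.2) 2) (Nat.cast_nonneg _)
      _ = _ := by
          rw [Finset.prod_const, Finset.card_univ, card_pair_subtype hij]
  rw [hinner]
  refine (re_sum_mul_reduced_le e κ htrκ φ).trans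
    (mul_le_mul_of_nonneg_right ?_ (Real.sqrt_nonneg _))
  exact (Real.sqrt_le_sqrt hfrob).trans_eq (Real.sqrt_sq (by positivity))

theorem norm_rotatedHam_sq_le {h : Matrix (Fin d) (Fin d) ℂ} (hh : h.IsHermitian)
    (htr : Matrix.trace h = 0) (V : Fin N → unitaryGroup (Fin d) ℂ)
    {φ : EuclideanSpace ℂ (Fin N → Fin d)} (hφ : ‖φ‖ = 1) :
    ‖rotatedHam h V φ‖ ^ 2 ≤ ∑ i : Fin N, ∑ j : Fin N, if i = j then opNorm h ^ 2 else
      d * opNorm h ^ 2 * Real.sqrt (deviation (splitPair d i j) φ) := by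
  set W : Matrix (Fin N → Fin d) (Fin N → Fin d) ℂ :=
    tensorProd fun j => (V j : Matrix (Fin d) (Fin d) ℂ) with hW
  have hsum : rotatedHam h V φ = ∑ k, mulVecE (siteMatrix k h * W) φ := by
    rw [rotatedHam, localHam_eq_sum, ← hW, Finset.sum_mul]
    simp only [mulVecE, map_sum, _root_.sum_apply]
  have hsq : ‖rotatedHam h V φ‖ ^ 2 = ∑ i, ∑ j,
      (inner ℂ (mulVecE (siteMatrix i h * W) φ) (mulVecE (siteMatrix j h * W) φ)).re := by
    rw [← inner_self_eq_norm_sq (𝕜 := ℂ), hsum, sum_inner, map_sum]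
    refine Finset.sum_congr rfl fun i _ => ?_
    rw [inner_sum, map_sum]
    rfl
  rw [hsq]
  refine Finset.sum_le_sum fun i _ => Finset.sum_le_sum fun j _ => ?_
  split_ifs with hij
  · subst hij
    have h1 := inner_self_eq_norm_sq (𝕜 := ℂ) (mulVecE (siteMatrix i h * W) φ)
    refine h1.trans_le (pow_le_pow_left₀ (norm_nonneg _) ?_ 2)
    rw [mulVecE_mul]
    refine (ContinuousLinearMap.le_of_opNorm_le _ (opNorm_siteMatrix_le i h) _).trans_eq ?_
    rw [norm_mulVecE_of_mem (tensorProd_mem_unitaryGroup V), hφ, mul_one]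
  · set E : Fin N → Fin N → Matrix (Fin d) (Fin d) ℂ := fun k => Function.update 1 k h with hE
    have hEs : ∀ k, E k k = h := fun k => by simp [hE]
    have hEne : ∀ k l, l ≠ k → E k l = 1 := fun k l hl => by simp [hE, hl]
    have hK : star (siteMatrix i h * W) * (siteMatrix j h * W) = tensorProd fun k =>
        star (V k : Matrix (Fin d) (Fin d) ℂ) *
          (E i k * E j k) * (V k).1 := by
      have hstar : star (siteMatrix i h) = siteMatrix i h := by
        have := map_star (siteHom (N := N) i) h
        rw [star_eq_conjTranspose, hh.eq] at this
        exact this.symm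
      rw [star_mul, hstar, hW, star_tensorProd, siteMatrix_eq_tensorProd, siteMatrix_eq_tensorProd,
        tensorProd_mul, tensorProd_mul, tensorProd_mul]
      congr 1
      funext k
      simp only [Pi.mul_apply, Pi.star_apply, mul_assoc]
      rfl
    have hKi : star (V i : Matrix (Fin d) (Fin d) ℂ) *
          (E i i * E j i) * (V i).1 =
        star (V i).1 * h * (V i).1 := by
      rw [hEs, hEne j i hij, mul_one]
    have hKj : star (V j : Matrix (Fin d) (Fin d) ℂ) *
          (E i j * E j j) * (V j).1 =
        star (V j).1 * h * (V j).1 := by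
      rw [hEs, hEne i j (Ne.symm hij), one_mul]
    rw [inner_mulVecE_mulVecE, hK]
    refine re_inner_tensorProd_le hij (fun k hk => ?_) ?_ (fun k hk => ?_) φ
    · rw [not_or] at hk
      rw [hEne i k hk.1, hEne j k hk.2, mul_one, mul_one]
      exact mem_unitaryGroup_iff'.1 (V k).2
    · rw [hKi, trace_mul_cycle, mem_unitaryGroup_iff.1 (V i).2, one_mul, htr]
    · rcases hk with rfl | rfl
      · rw [hKi]; exact opNorm_conj_le (V _).2 h
      · rw [hKj]; exact opNorm_conj_le (V _).2 h

theorem continuous_supNorm_rotatedHam (h : Matrix (Fin d) (Fin d) ℂ) :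
    Continuous (supNorm (rotatedHam (N := N) h)) :=
  continuous_supNorm (norm_rotatedHam_le h) (mul_nonneg (Nat.cast_nonneg _) (norm_nonneg _))

theorem IsInvariantOnSphere.integral_supNorm_rotatedHam_sq_le
    {ν : Measure (EuclideanSpace ℂ (Fin N → Fin d))} [IsProbabilityMeasure ν]
    (hν : IsInvariantOnSphere ν) (hd : 2 ≤ d) (hN : 1 ≤ N)
    {h : Matrix (Fin d) (Fin d) ℂ} (hh : h.IsHermitian) (htr : Matrix.trace h = 0) :
    ∫ φ, supNorm (rotatedHam h) φ ^ 2 ∂ν ≤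
      N * opNorm h ^ 2 * (1 + (N - 1) * d ^ 2 / Real.sqrt (d ^ N)) := by
  have hcard : Fintype.card (Fin N → Fin d) = d ^ N := by simp
  have hn : 2 ≤ Fintype.card (Fin N → Fin d) := by
    rw [hcard]; exact hd.trans (Nat.le_self_pow (by omega) d)
  have : Nonempty (Fin d) := ⟨⟨0, by omega⟩⟩
  have hd0 : (0 : ℝ) < d := by exact_mod_cast (by omega : 0 < d)
  have hint : ∀ i j : Fin N, Integrable (fun φ => if i = j then opNorm h ^ 2 else
      d * opNorm h ^ 2 * Real.sqrt (deviation (splitPair d i j) φ)) ν := by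
    intro i j
    split_ifs
    · exact integrable_const _
    · exact (hν.integrable (continuous_deviation _).sqrt).const_mul _
  calc ∫ φ, supNorm (rotatedHam h) φ ^ 2 ∂ν
      ≤ ∫ φ, ∑ i : Fin N, ∑ j : Fin N, (if i = j then opNorm h ^ 2 else
          d * opNorm h ^ 2 * Real.sqrt (deviation (splitPair d i j) φ)) ∂ν :=
        integral_mono_ae (hν.integrable ((continuous_supNorm_rotatedHam h).pow 2))
          (integrable_finsetSum _ fun i _ => integrable_finsetSum _ fun j _ => hint i j)
          (hν.norm_eq.mono fun φ hφ => supNorm_sq_le fun V => norm_rotatedHam_sq_le hh htr V hφ)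
    _ = ∑ i : Fin N, ∑ j : Fin N, ∫ φ, (if i = j then opNorm h ^ 2 else
          d * opNorm h ^ 2 * Real.sqrt (deviation (splitPair d i j) φ)) ∂ν := by
        rw [integral_finsetSum _ fun i _ => integrable_finsetSum _ fun j _ => hint i j]
        exact Finset.sum_congr rfl fun i _ => integral_finsetSum _ fun j _ => hint i j
    _ ≤ ∑ i : Fin N, ∑ j : Fin N, ((if i = j then
          opNorm h ^ 2 - opNorm h ^ 2 * (d ^ 2 / Real.sqrt (d ^ N)) else 0) +
          opNorm h ^ 2 * (d ^ 2 / Real.sqrt (d ^ N))) := by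
        refine Finset.sum_le_sum fun i _ => Finset.sum_le_sum fun j _ => ?_
        split_ifs with hij
        · simp
        · rw [integral_const_mul, zero_add]
          have h1 := hν.integral_sqrt_deviation_le (splitPair d i j) hn
          have h2 : Real.sqrt (Fintype.card ({k // k = i ∨ k = j} → Fin d) /
              Fintype.card (Fin N → Fin d)) = d / Real.sqrt (d ^ N) := by
            rw [hcard, Fintype.card_fun, card_pair_subtype hij, Fintype.card_fin]
            push_cast
            rw [Real.sqrt_div (by positivity), Real.sqrt_sq hd0.le]
          rw [h2] at h1
          calc d * opNorm h ^ 2 * ∫ φ, Real.sqrt (deviation (splitPair d i j) φ) ∂ν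
              ≤ d * opNorm h ^ 2 * (d / Real.sqrt (d ^ N)) := by gcongr
            _ = _ := by ring
    _ = _ := by
        simp only [Finset.sum_add_distrib, Finset.sum_ite_eq, Finset.mem_univ, if_true,
          Finset.sum_const, Finset.card_univ, Fintype.card_fin, nsmul_eq_mul]
        ring

end Pairs

/-- upper-tail concentration bound for the LU-optimized QFI of Haar-random
pure states of `N` distinguishable particles. -/
theorem flu_upper_tail (d N : ℕ) (hd : 2 ≤ d) (hN : 1 ≤ N)
    (h : Matrix (Fin d) (Fin d) ℂ) (hherm : h.IsHermitian) (htr : Matrix.trace h = 0)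
    (ψ : (Fin N → Fin d) → ℂ) (hψ : ∑ x, ‖ψ x‖ ^ 2 = 1)
    (μ : Measure (Matrix.specialUnitaryGroup (Fin N → Fin d) ℂ))
    [IsProbabilityMeasure μ] [μ.IsMulLeftInvariant]
    (ε : ℝ) (hε : 0 ≤ ε) :
    μ {U | 4 * N * opNorm h ^ 2 * (1 + (N - 1) * d ^ 2 / Real.sqrt (d ^ N)) + ε ≤ FLU d N h ψ U}
      ≤ ENNReal.ofReal
          (Real.exp (-(ε ^ 2 * d ^ N / (4096 * opNorm h ^ 4 * N ^ 4)))) := by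
  have hcard : Fintype.card (Fin N → Fin d) = d ^ N := by simp
  have hn : 2 ≤ Fintype.card (Fin N → Fin d) := by
    rw [hcard]; exact hd.trans (Nat.le_self_pow (by omega) d)
  have hψ' : ‖(WithLp.toLp 2 ψ : EuclideanSpace ℂ (Fin N → Fin d))‖ = 1 := by
    rw [EuclideanSpace.norm_eq, hψ, Real.sqrt_one]
  rcases (norm_nonneg _ : 0 ≤ opNorm h).eq_or_lt with h0 | h0
  · have h1 : opNorm h = 0 := h0.symm
    simpa [h1] using (prob_le_one : μ _ ≤ 1)
  set ψE : EuclideanSpace ℂ (Fin N → Fin d) := WithLp.toLp 2 ψ with hψE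
  set ν := orbitMeasure μ ψE
  set G := supNorm (rotatedHam (N := N) h) with hG
  set ℓ : ℝ := N * opNorm h with hℓdef
  have hN0 : (0 : ℝ) < N := by exact_mod_cast hN
  have hℓ : 0 < ℓ := mul_pos hN0 h0
  have hν : IsInvariantOnSphere ν := isInvariantOnSphere_orbitMeasure μ hn hψ'
  have hGc : Continuous G := continuous_supNorm_rotatedHam h
  have hGi : Integrable G ν := hν.integrable hGc
  have hGle : ∀ φ : EuclideanSpace ℂ (Fin N → Fin d), ‖φ‖ = 1 → G φ ≤ ℓ := fun φ hφ => by
    simpa [hφ] using supNorm_le (norm_rotatedHam_le (N := N) h) φ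
  have hmean : ∫ φ, G φ ∂ν ≤ ℓ := by
    refine (integral_mono_ae hGi (integrable_const ℓ) (hν.norm_eq.mono hGle)).trans_eq ?_
    simp
  have hmean_sq : (∫ φ, G φ ∂ν) ^ 2 ≤ ∫ φ, G φ ^ 2 ∂ν := by
    have h1 := ProbabilityTheory.variance_nonneg G ν
    rw [ProbabilityTheory.variance_eq_sub
      ((memLp_two_iff_integrable_sq hGc.aestronglyMeasurable).2 (hν.integrable (hGc.pow 2)))] at h1
    exact sub_nonneg.1 h1
  have htail := measure_angular_ge_le (isGaussianAngularPart_orbitMeasure μ hn hψ')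
    hGc.measurable hℓ (isSupOfDuals_supNorm (norm_rotatedHam_le h)) supNorm_smul hGi
    (s := ε / (8 * ℓ)) (by positivity)
  have hsub : {U : specialUnitaryGroup (Fin N → Fin d) ℂ |
      4 * N * opNorm h ^ 2 * (1 + (N - 1) * d ^ 2 / Real.sqrt (d ^ N)) + ε ≤ FLU d N h ψ U} ⊆
      (fun U => mulVecE U.1 ψE) ⁻¹' {φ | (∫ x, G x ∂ν) + ε / (8 * ℓ) ≤ G φ} := by
    intro U hU
    have h1 := le_trans hU (FLU_le_supNorm_sq hherm ψ U)
    have h2 := hν.integral_supNorm_rotatedHam_sq_le hd hN hherm htr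
    have h3 : G (mulVecE U.1 ψE) ≤ ℓ := hGle _ (by
      rw [norm_mulVecE_of_mem (mem_specialUnitaryGroup_iff.1 U.2).1, hψ'])
    have h4 : 0 ≤ ∫ φ, G φ ∂ν := integral_nonneg supNorm_nonneg
    have h5 : 0 ≤ G (mulVecE U.1 ψE) := supNorm_nonneg _
    have h6 : 4 * (∫ φ, G φ ∂ν) ^ 2 + ε ≤ 4 * G (mulVecE U.1 ψE) ^ 2 := by
      rw [← hψE, ← hG] at h1
      linarith
    change (∫ φ, G φ ∂ν) + ε / (8 * ℓ) ≤ G (mulVecE U.1 ψE)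
    rw [← le_sub_iff_add_le', div_le_iff₀ (by positivity)]
    have h7 : ∫ φ, G φ ∂ν ≤ G (mulVecE U.1 ψE) := (sq_le_sq₀ h4 h5).1 (by linarith)
    have h8 := mul_nonneg (sub_nonneg.2 h7) (sub_nonneg.2 (add_le_add h3 hmean))
    linarith
  refine (measure_mono hsub).trans ?_
  rw [← Measure.map_apply (measurable_mulVecE_left ψE)
    (measurableSet_le measurable_const hGc.measurable)]
  refine htail.trans (ENNReal.ofReal_le_ofReal (Real.exp_le_exp.2 (neg_le_neg ?_)))
  have hfin : (Module.finrank ℝ (EuclideanSpace ℂ (Fin N → Fin d)) : ℝ) = 2 * d ^ N := by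
    rw [← Module.finrank_mul_finrank ℝ ℂ]
    simp [Complex.finrank_real_complex]
  have hpi : Real.pi ^ 2 ≤ 10 := by nlinarith [Real.pi_lt_d2, Real.pi_pos]
  rw [hfin]
  have e1 : ε ^ 2 * d ^ N / (4096 * opNorm h ^ 4 * N ^ 4) =
      ε ^ 2 * d ^ N / ℓ ^ 4 * (1 / 4096) := by
    rw [hℓdef]; field_simp
  have e2 : 9 / 50 * (2 * (d : ℝ) ^ N) * (ε / (8 * ℓ)) ^ 2 / (ℓ ^ 2 * Real.pi ^ 2) =
      ε ^ 2 * d ^ N / ℓ ^ 4 * (9 / 1600 / Real.pi ^ 2) := by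
    field_simp; ring
  rw [e1, e2]
  refine mul_le_mul_of_nonneg_left ?_ (by positivity)
  rw [div_le_div_iff₀ (by norm_num) (by positivity)]
  linarith

end Paper
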